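/- arXiv:2303.17435 — 3 statements merged into one kernel-verified Lean document; each statement's English description precedes it below -/
import Mathlib

section
/- Let F be an algebraically closed field, n ≥ 2, and let u ∈ SL_n(F) be a unipotent element (i.e., (u − 1)^n = 0 as a matrix) with u ≠ 1. Let d = dim_F {x ∈ M_n(F) : x·u = u·x} be the dimension of the commutant of u in the n×n matrices, so d < n². Let C = {h u h⁻¹ : h ∈ SL_n(F)} be the conjugacy class of u. Then there exists a positive integer k with k·(n² − d) ≤ 4608·(n² − 1) such that C^k = SL_n(F). -/
open Pointwise

open Matrix

theorem isConj_reindex {R ι κ : Type*} [CommRing R] [Fintype ι] [DecidableEq ι] [Fintype κ]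
    [DecidableEq κ] (e : ι ≃ κ) {A B : Matrix ι ι R} (h : IsConj A B) :
    IsConj (reindex e e A) (reindex e e B) :=
  (reindexAlgEquiv R R e).toAlgHom.toMonoidHom.map_isConj h

theorem isConj_fromBlocks {R ι κ : Type*} [CommRing R] [Fintype ι] [DecidableEq ι] [Fintype κ]
    [DecidableEq κ] {A A' : Matrix ι ι R} {D D' : Matrix κ κ R} (X : Matrix ι κ R)
    (Y : Matrix κ ι R) (hA : IsConj A A') (hD : IsConj D D') :
    ∃ X' Y', IsConj (fromBlocks A X Y D) (fromBlocks A' X' Y' D') ∧ (X = 0 → X' = 0) ∧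
      (Y = 0 → Y' = 0) := by
  obtain ⟨P, hP⟩ := hA
  obtain ⟨Q, hQ⟩ := hD
  refine ⟨P.val * X * Q⁻¹.val, Q.val * Y * P⁻¹.val,
    ⟨⟨fromBlocks P.val 0 0 Q.val, fromBlocks P⁻¹.val 0 0 Q⁻¹.val, ?_, ?_⟩, ?_⟩, ?_, ?_⟩
  · simp [fromBlocks_multiply]
  · simp [fromBlocks_multiply]
  · have h1 := hP.eq
    have h2 := hQ.eq
    simp [SemiconjBy, fromBlocks_multiply, Matrix.mul_assoc, h1, h2]
  · rintro rfl; simp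
  · rintro rfl; simp

theorem isConj_diagonal_fromBlocks_zero₂₁ {F ι κ : Type*} [Field F] [Fintype ι] [DecidableEq ι]
    [Fintype κ] [DecidableEq κ] {A : Matrix ι ι F} {D : Matrix κ κ F} {a : ι → F} {d : κ → F}
    (X : Matrix ι κ F) (hA : IsConj A (diagonal a)) (hD : IsConj D (diagonal d))
    (had : ∀ i j, a i ≠ d j) :
    IsConj (fromBlocks A X 0 D) (diagonal (Sum.elim a d)) := by
  obtain ⟨X', Y', h, -, hY⟩ := isConj_fromBlocks X 0 hA hD
  rw [hY rfl] at h
  refine h.trans ?_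
  let Z : Matrix ι κ F := of fun i j => X' i j / (a i - d j)
  refine ⟨⟨fromBlocks 1 Z 0 1, fromBlocks 1 (-Z) 0 1, ?_, ?_⟩, ?_⟩
  · simp [fromBlocks_multiply]
  · simp [fromBlocks_multiply]
  · have : X' + Z * diagonal d = diagonal a * Z := by
      ext i j
      have := sub_ne_zero.2 (had i j)
      simp [Z, mul_diagonal, diagonal_mul]
      field_simp
      ring
    rw [SemiconjBy, Units.val_mk, ← fromBlocks_diagonal, fromBlocks_multiply, fromBlocks_multiply]
    simp [this]

theorem isConj_diagonal_fromBlocks_zero₁₂ {F ι κ : Type*} [Field F] [Fintype ι] [DecidableEq ι]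
    [Fintype κ] [DecidableEq κ] {A : Matrix ι ι F} {D : Matrix κ κ F} {a : ι → F} {d : κ → F}
    (Y : Matrix κ ι F) (hA : IsConj A (diagonal a)) (hD : IsConj D (diagonal d))
    (had : ∀ i j, a i ≠ d j) :
    IsConj (fromBlocks A 0 Y D) (diagonal (Sum.elim a d)) := by
  have h := isConj_reindex (Equiv.sumComm κ ι)
    (isConj_diagonal_fromBlocks_zero₂₁ Y hD hA fun i j => (had j i).symm)
  convert h using 1
  · ext (i | i) (j | j) <;> rfl
  · ext (i | i) (j | j) <;> simp [diagonal_apply]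

theorem exists_unit_mulVec_single {F ι κ : Type*} [Field F] [Fintype ι]
    [Fintype κ] [DecidableEq κ] (φ : ι → κ) (hφ : φ.Injective) (v : ι → κ → F)
    (hv : LinearIndependent F v) :
    ∃ P : (Matrix κ κ F)ˣ, ∀ i, P.val *ᵥ Pi.single (φ i) 1 = v i := by
  have hs : LinearIndependent F fun i => (Pi.single (φ i) 1 : κ → F) := by
    have := (Pi.basisFun F κ).linearIndependent.comp φ hφ
    simpa [Function.comp_def] using this
  obtain ⟨g, hg⟩ := Submodule.exists_linearEquiv_restrict_eq
    (hs.linearCombinationEquiv.symm.trans hv.linearCombinationEquiv)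
  refine ⟨⟨LinearMap.toMatrix' g.toLinearMap, LinearMap.toMatrix' g.symm.toLinearMap, ?_, ?_⟩,
    fun i => ?_⟩
  · simp [← LinearMap.toMatrix'_comp]
  · simp [← LinearMap.toMatrix'_comp]
  · have h1 := hg ⟨_, Submodule.subset_span ⟨i, rfl⟩⟩
    have h2 := hs.repr_eq_single i ⟨_, Submodule.subset_span ⟨i, rfl⟩⟩ rfl
    rw [LinearMap.toMatrix'_mulVec]
    rw [LinearIndependent.repr, LinearEquiv.coe_coe] at h2
    rw [LinearEquiv.trans_apply, h2] at h1
    simpa using h1.symm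

theorem exists_ne_zero_sq_eq_zero {F κ : Type*} [Field F] [Fintype κ] [DecidableEq κ]
    {N : Matrix κ κ F} (hN : IsNilpotent N) (h0 : N ≠ 0) :
    ∃ w, N *ᵥ w ≠ 0 ∧ N *ᵥ (N *ᵥ w) = 0 := by
  have hk : ∃ k, N ^ k = 0 := hN
  classical
  let k := Nat.find hk
  have hk1 : N ^ k = 0 := Nat.find_spec hk
  have hk2 : 1 < k := by
    by_contra h
    apply h0
    have := pow_eq_zero_of_le (not_lt.1 h) hk1
    simpa using this
  have hk3 : N ^ (k - 1) ≠ 0 := Nat.find_min hk (by omega)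
  obtain ⟨x, hx⟩ : ∃ x, N ^ (k - 1) *ᵥ x ≠ 0 := by
    by_contra! h
    exact hk3 (Matrix.ext_of_mulVec_single fun i => by rw [h, zero_mulVec])
  refine ⟨N ^ (k - 2) *ᵥ x, ?_, ?_⟩
  · rwa [mulVec_mulVec, ← pow_succ', show k - 2 + 1 = k - 1 by omega]
  · rw [mulVec_mulVec, mulVec_mulVec, ← pow_two, ← pow_add, show 2 + (k - 2) = k by omega, hk1,
      zero_mulVec]

theorem exists_isConj_fromBlocks_of_isNilpotent {F κ : Type*} [Field F] [Fintype κ]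
    [DecidableEq κ] {N : Matrix κ κ F} (hN : IsNilpotent N) (h0 : N ≠ 0) :
    ∃ (m : ℕ) (e : Fin 2 ⊕ Fin m ≃ κ) (X : Matrix (Fin 2) (Fin m) F)
      (N' : Matrix (Fin m) (Fin m) F),
      IsConj N (reindex e e (fromBlocks !![0, 1; 0, 0] X 0 N')) := by
  obtain ⟨w, hw, hw'⟩ := exists_ne_zero_sq_eq_zero hN h0
  have hv : LinearIndependent F ![N *ᵥ w, w] := by
    rw [LinearIndependent.pair_iff]
    intro s t hst
    have ht : t = 0 := by
      have := congrArg (N *ᵥ ·) hst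
      simpa [mulVec_add, mulVec_smul, hw', hw] using this
    subst ht
    simpa [hw] using hst
  have hc : 2 ≤ Fintype.card κ := by
    simpa using hv.fintype_card_le_finrank
  let e : Fin 2 ⊕ Fin (Fintype.card κ - 2) ≃ κ := Fintype.equivOfCardEq (by simp; omega)
  obtain ⟨P, hP⟩ := exists_unit_mulVec_single (fun i => e (Sum.inl i))
    (e.injective.comp Sum.inl_injective) _ hv
  let M := P⁻¹.val * N * P.val
  have hM : IsConj N M := ⟨P⁻¹, by simp [M, SemiconjBy, mul_assoc]⟩
  have hM0 : M *ᵥ Pi.single (e (Sum.inl 0)) 1 = 0 := by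
    rw [← mulVec_mulVec, ← mulVec_mulVec, hP]
    simp [hw']
  have hM1 : M *ᵥ Pi.single (e (Sum.inl 1)) 1 = Pi.single (e (Sum.inl 0)) 1 := by
    have h0 := hP 0
    simp only [cons_val_zero] at h0
    rw [← mulVec_mulVec, ← mulVec_mulVec, hP]
    simp only [cons_val_one]
    rw [cons_val_fin_one, ← h0, mulVec_mulVec, Units.inv_mul, one_mulVec]
  let M' := reindex e.symm e.symm M
  refine ⟨_, e, M'.toBlocks₁₂, M'.toBlocks₂₂, ?_⟩
  convert hM
  suffices fromBlocks !![0, 1; 0, 0] M'.toBlocks₁₂ 0 M'.toBlocks₂₂ = M' by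
    rw [this]; ext; simp [M']
  rw [mulVec_single_one] at hM0 hM1
  rw [← fromBlocks_toBlocks M']
  have h (i : Fin 2 ⊕ Fin (Fintype.card κ - 2)) := congrFun hM0 (e i)
  have h' (i : Fin 2 ⊕ Fin (Fintype.card κ - 2)) := congrFun hM1 (e i)
  simp only [col_apply, Pi.zero_apply, Pi.single_apply, e.injective.eq_iff] at h h'
  congr 1
  · ext i j
    fin_cases i <;> fin_cases j <;> simp [M', toBlocks₁₁, h, h']
  · ext i j
    fin_cases j <;> simp [M', toBlocks₂₁, h, h']

theorem exists_isConj_jordan_mul_isConj_diagonal {F : Type*} [Field F] {a b : F} (hab : a * b = 1)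
    (ha : a ≠ 1) (hne : a ≠ b) :
    ∃ B : Matrix (Fin 2) (Fin 2) F, IsConj !![1, 1; 0, 1] B ∧
      IsConj (!![1, 1; 0, 1] * B) (diagonal ![a, b]) := by
  have ha0 : a ≠ 0 := left_ne_zero_of_mul_eq_one hab
  obtain rfl : b = a⁻¹ := (inv_eq_of_mul_eq_one_right hab).symm
  have h1 : a - 1 ≠ 0 := sub_ne_zero.2 ha
  have h2 : a + 1 ≠ 0 := by
    intro h
    apply hne
    rw [eq_neg_of_add_eq_zero_left h]
    norm_num
  have hd1 : IsUnit (!![0, 1; (a - 1) ^ 2 / a, 0] : Matrix (Fin 2) (Fin 2) F) := by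
    rw [Matrix.isUnit_iff_isUnit_det, isUnit_iff_ne_zero, det_fin_two_of]
    simp [h1, ha0]
  have hd2 : IsUnit (!![a, 1; a - 1, 1 - a] : Matrix (Fin 2) (Fin 2) F) := by
    rw [Matrix.isUnit_iff_isUnit_det, isUnit_iff_ne_zero, det_fin_two_of,
      show a * (1 - a) - 1 * (a - 1) = -((a - 1) * (a + 1)) by ring]
    exact neg_ne_zero.2 (mul_ne_zero h1 h2)
  obtain ⟨g, hg⟩ := hd1
  obtain ⟨p, hp⟩ := hd2
  refine ⟨!![1, 0; (a - 1) ^ 2 / a, 1], ⟨g, ?_⟩, IsConj.symm ⟨p, ?_⟩⟩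
  · rw [hg, SemiconjBy]
    simp
  · rw [hp, SemiconjBy]
    ext i j
    fin_cases i <;> fin_cases j <;> simp [mul_diagonal] <;> field_simp <;> ring

theorem IsConj.one_add {R : Type*} [Semiring R] {a b : R} (h : IsConj a b) :
    IsConj (1 + a) (1 + b) := by
  obtain ⟨c, hc⟩ := h
  exact ⟨c, by simp [SemiconjBy, mul_add, add_mul, hc.eq]⟩

theorem IsConj.isNilpotent {R : Type*} [Ring R] {a b : R} (h : IsConj a b)
    (ha : IsNilpotent a) : IsNilpotent b := by
  obtain ⟨c, hc⟩ := h
  obtain ⟨k, hk⟩ := ha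
  refine ⟨k, ?_⟩
  have := hc.pow_right k
  rw [SemiconjBy, hk, mul_zero] at this
  exact (Units.mul_left_eq_zero c).1 this.symm

theorem isNilpotent_of_fromBlocks_zero₂₁ {R ι κ : Type*} [CommRing R] [Fintype ι] [DecidableEq ι]
    [Fintype κ] [DecidableEq κ] {A : Matrix ι ι R} {X : Matrix ι κ R} {D : Matrix κ κ R}
    (h : IsNilpotent (fromBlocks A X 0 D)) : IsNilpotent D := by
  obtain ⟨k, hk⟩ := h
  have : ∀ k, ∃ A' X', fromBlocks A X 0 D ^ k = fromBlocks A' X' 0 (D ^ k) := by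
    intro k
    induction k with
    | zero => exact ⟨1, 0, by simp⟩
    | succ k ih =>
      obtain ⟨A', X', h⟩ := ih
      exact ⟨_, _, by rw [pow_succ, h, fromBlocks_multiply]; simp [pow_succ]; exact ⟨rfl, rfl⟩⟩
  obtain ⟨A', X', h⟩ := this k
  refine ⟨k, ?_⟩
  rw [hk] at h
  have := congrArg toBlocks₂₂ h
  rw [toBlocks_fromBlocks₂₂] at this
  exact this.symm

theorem rank_fromBlocks_zero₂₁_le {F ι κ : Type*} [Field F] [Fintype ι] [DecidableEq ι]
    [Fintype κ] [DecidableEq κ] (A : Matrix ι ι F) (X : Matrix ι κ F) (D : Matrix κ κ F) :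
    (fromBlocks A X 0 D).rank ≤ Fintype.card ι + D.rank := by
  have h : fromBlocks A X 0 D =
      fromRows (1 : Matrix ι ι F) 0 * fromCols A X +
        fromRows (0 : Matrix ι κ F) 1 * D * fromCols (0 : Matrix κ ι F) 1 := by
    rw [fromRows_mul_fromCols, fromRows_mul]
    ext (i | i) (j | j) <;> simp
  rw [h, rank, mulVecLin_add]
  refine (Submodule.finrank_mono (LinearMap.range_add_le _ _)).trans <|
    (Submodule.finrank_add_le_finrank_add_finrank _ _).trans (add_le_add ?_ ?_)
  · exact (rank_mul_le_left _ _).trans (rank_le_card_width _)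
  · exact (rank_mul_le_left _ _).trans (rank_mul_le_right _ _)

theorem IsConj.rank_eq {F κ : Type*} [Field F] [Fintype κ] [DecidableEq κ] {A B : Matrix κ κ F}
    (h : IsConj A B) : A.rank = B.rank := by
  obtain ⟨c, hc⟩ := h
  have hu : IsUnit c.val.det := (Matrix.isUnit_iff_isUnit_det _).1 c.isUnit
  rw [← rank_mul_eq_right_of_isUnit_det _ A hu, hc.eq, rank_mul_eq_left_of_isUnit_det _ B hu]

theorem exists_pairs_mul_isConj_diagonal {F : Type*} [Field F] (n : ℕ) :
    ∀ (κ : Type) [Fintype κ] [DecidableEq κ] (N : Matrix κ κ F), Fintype.card κ = n →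
    IsNilpotent N → ∃ (s : ℕ) (f : Fin s × Fin 2 → κ), f.Injective ∧ N.rank ≤ 2 * s ∧
      ∀ x : Fin s × Fin 2 → F, x.Injective → (∀ p, x p ≠ 1) → (∀ k, x (k, 0) * x (k, 1) = 1) →
      ∀ d : κ → F, (∀ p, d (f p) = x p) → (∀ i ∉ Set.range f, d i = 1) →
      ∃ A B, IsConj (1 + N) A ∧ IsConj (1 + N) B ∧ IsConj (A * B) (diagonal d) := by
  induction n using Nat.strong_induction_on with
  | _ n ih =>
  intro κ _ _ N hn hN
  by_cases h0 : N = 0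
  · subst h0
    refine ⟨0, fun p => p.1.elim0, fun p => p.1.elim0, by simp, fun x _ _ _ d _ hd => ?_⟩
    refine ⟨1, 1, by simp, by simp, ?_⟩
    have : d = 1 := funext fun i => hd i fun ⟨p, _⟩ => p.1.elim0
    subst this
    simp [Pi.one_def]
  obtain ⟨m, e, X, N', hNe⟩ := exists_isConj_fromBlocks_of_isNilpotent hN h0
  have hN' : IsNilpotent N' := by
    have h := isConj_reindex e.symm hNe
    rw [reindex_apply, reindex_apply, reindex_apply] at h
    simp at h
    exact isNilpotent_of_fromBlocks_zero₂₁ (h.isNilpotent (hN.map (reindexAlgEquiv F F e.symm)))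
  have hm : m < n := by
    have := Fintype.card_congr e
    simp at this
    omega
  obtain ⟨s, f, hf, hs, H⟩ := ih m hm (Fin m) N' (by simp) hN'
  refine ⟨s + 1, fun p => Fin.cases (e (Sum.inl p.2)) (fun k => e (Sum.inr (f (k, p.2)))) p.1,
    ?_, ?_, ?_⟩
  · rintro ⟨i, b⟩ ⟨j, c⟩ h
    cases i using Fin.cases <;> cases j using Fin.cases <;> simp at h
    · simp [h]
    · have := hf h
      simp_all
  · rw [hNe.rank_eq, reindex_apply, rank_submatrix]
    refine (rank_fromBlocks_zero₂₁_le _ _ _).trans ?_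
    simp
    omega
  · intro x hx hx1 hxx d hd hd1
    have hd0 : ∀ b, d (e (Sum.inl b)) = x (0, b) := fun b => hd (0, b)
    have hds : ∀ k b, d (e (Sum.inr (f (k, b)))) = x (k.succ, b) := fun k b => hd (k.succ, b)
    have hdr : ∀ i ∉ Set.range f, d (e (Sum.inr i)) = 1 := by
      intro i hi
      apply hd1
      rintro ⟨⟨k, b⟩, h⟩
      cases k using Fin.cases with
      | zero => simp at h
      | succ k => exact hi ⟨(k, b), by simpa using h⟩
    obtain ⟨A', B', hA', hB', hAB'⟩ := H (fun p => x (p.1.succ, p.2))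
      (fun p q h => by
        have := hx h
        simp at this
        exact Prod.ext this.1 this.2) (fun p => hx1 _) (fun k => hxx _)
      (fun i => d (e (Sum.inr i))) (fun p => hds p.1 p.2) hdr
    obtain ⟨B, hB, hAB⟩ := exists_isConj_jordan_mul_isConj_diagonal (hxx 0) (hx1 _)
      (fun h => by simpa using hx h)
    have hJ : 1 + reindex e e (fromBlocks !![0, 1; 0, 0] X 0 N') =
        reindex e e (fromBlocks !![1, 1; 0, 1] X 0 (1 + N')) := by
      ext i j
      obtain ⟨i, rfl⟩ := e.surjective i
      obtain ⟨j, rfl⟩ := e.surjective j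
      rcases i with i | i <;> rcases j with j | j <;>
        simp [one_apply] <;> fin_cases i <;> fin_cases j <;> simp
    have hU := hNe.one_add
    rw [hJ] at hU
    obtain ⟨X₁, Y₁, h₁, -, hY₁⟩ := isConj_fromBlocks X 0 (IsConj.refl !![1, 1; 0, 1]) hA'
    obtain ⟨X₂, Y₂, h₂, -, hY₂⟩ := isConj_fromBlocks X 0 hB hB'
    rw [hY₁ rfl] at h₁
    rw [hY₂ rfl] at h₂
    refine ⟨_, _, hU.trans (isConj_reindex e h₁), hU.trans (isConj_reindex e h₂), ?_⟩
    rw [reindex_apply, reindex_apply, submatrix_mul_equiv, fromBlocks_multiply]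
    simp only [Matrix.mul_zero, Matrix.zero_mul, add_zero, zero_add]
    have hne : ∀ i j, ![x (0, 0), x (0, 1)] i ≠ d (e (Sum.inr j)) := by
      intro i j
      have hi : ![x (0, 0), x (0, 1)] i = x (0, i) := by fin_cases i <;> rfl
      rw [hi]
      by_cases hj : j ∈ Set.range f
      · obtain ⟨⟨k, b⟩, rfl⟩ := hj
        rw [hds]
        intro h
        have := hx h
        simp [Fin.ext_iff] at this
      · rw [hdr j hj]
        exact hx1 _
    refine (isConj_reindex e (isConj_diagonal_fromBlocks_zero₂₁ _ hAB hAB' hne)).trans ?_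
    rw [reindex_apply, submatrix_diagonal_equiv]
    convert IsConj.refl _ using 2
    ext i
    obtain ⟨i, rfl⟩ := e.surjective i
    rcases i with i | i
    · fin_cases i <;> simp [hd0]
    · simp

theorem exists_linearIndependent_mulVec {F κ : Type*} [Field F] [Fintype κ] [DecidableEq κ]
    {A : Matrix κ κ F} (hA : ∀ c : F, A ≠ c • 1) : ∃ v, LinearIndependent F ![v, A *ᵥ v] := by
  by_contra! h
  obtain ⟨c, hc⟩ := LinearMap.exists_eq_smul_id_of_forall_notLinearIndependent
    (f := toLin' A) (by simpa using h)
  apply hA c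
  have := congrArg LinearMap.toMatrix' hc
  simpa [Module.End.one_eq_id] using this

theorem exists_isConj_fromBlocks_single {F κ : Type*} [Field F] [Fintype κ] [DecidableEq κ]
    {m : ℕ} (e : Fin 1 ⊕ Fin (m + 1) ≃ κ) {A : Matrix κ κ F} (hA : ∀ c : F, A ≠ c • 1) (a : F) :
    ∃ (y : Matrix (Fin 1) (Fin (m + 1)) F) (D : Matrix (Fin (m + 1)) (Fin (m + 1)) F),
      IsConj A (reindex e e (fromBlocks (a • 1) y (of fun i _ => if i = 0 then 1 else 0) D)) := by
  obtain ⟨v, hv⟩ := exists_linearIndependent_mulVec hA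
  have hv : LinearIndependent F ![v, A *ᵥ v - a • v] := by
    rw [LinearIndependent.pair_iff] at hv ⊢
    intro s t hst
    have := hv (s - t * a) t (by rw [← hst]; module)
    obtain ⟨h1, rfl⟩ := this
    simpa using h1
  let φ : Fin 2 → κ := ![e (Sum.inl 0), e (Sum.inr 0)]
  have hφ : φ.Injective := by
    intro i j
    fin_cases i <;> fin_cases j <;> simp [φ]
  obtain ⟨P, hP⟩ := exists_unit_mulVec_single φ hφ _ hv
  have hP0 := hP 0
  have hP1 := hP 1
  simp only [cons_val_zero, cons_val_one, cons_val_fin_one, φ] at hP0 hP1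
  let M := P⁻¹.val * A * P.val
  have hM : IsConj A M := ⟨P⁻¹, by simp [M, SemiconjBy, mul_assoc]⟩
  have hM0 : M *ᵥ Pi.single (e (Sum.inl 0)) 1 =
      a • Pi.single (e (Sum.inl 0)) 1 + Pi.single (e (Sum.inr 0)) 1 := by
    rw [← mulVec_mulVec, ← mulVec_mulVec, hP0,
      show A *ᵥ v = P.val *ᵥ (a • Pi.single (e (Sum.inl 0)) 1 + Pi.single (e (Sum.inr 0)) 1) by
        rw [mulVec_add, mulVec_smul, hP0, hP1]; abel,
      mulVec_mulVec, Units.inv_mul, one_mulVec]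
  let M' := reindex e.symm e.symm M
  refine ⟨M'.toBlocks₁₂, M'.toBlocks₂₂, ?_⟩
  convert hM
  rw [mulVec_single_one] at hM0
  ext i j
  obtain ⟨i, rfl⟩ := e.surjective i
  obtain ⟨j, rfl⟩ := e.surjective j
  rcases j with j | j
  · obtain rfl := Subsingleton.elim j 0
    have := congrFun hM0 (e i)
    rcases i with i | i
    · obtain rfl := Subsingleton.elim i 0
      simpa [col_apply, Pi.single_apply] using this.symm
    · simpa [col_apply, Pi.single_apply] using this.symm
  · rcases i with i | i <;> simp [M', toBlocks₁₂, toBlocks₂₂]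

theorem fromBlocks_eq_lower_mul_upper {F ι : Type*} [Field F] [Fintype ι] [DecidableEq ι] {a : F}
    (ha : a ≠ 0) (y : Matrix (Fin 1) ι F) (z : Matrix ι (Fin 1) F) (D : Matrix ι ι F) :
    fromBlocks (a • 1) y z D =
      fromBlocks 1 0 (a⁻¹ • z) 1 * fromBlocks (a • 1) y 0 (D - a⁻¹ • (z * y)) := by
  simp [fromBlocks_multiply, smul_smul, ha]

theorem exists_isConj_lower_mul_upper {F κ : Type*} [Field F] [Fintype κ] [DecidableEq κ]
    {m : ℕ} (e : Fin 1 ⊕ Fin (m + 1) ≃ κ) {A : Matrix κ κ F} (hdet : A.det ≠ 0)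
    (hA : ∀ c : F, A ≠ c • 1) {a : F} (ha : a ≠ 0) :
    ∃ (y : Matrix (Fin 1) (Fin (m + 1)) F)
      (z : Matrix (Fin (m + 1)) (Fin 1) F) (D : Matrix (Fin (m + 1)) (Fin (m + 1)) F),
      IsConj A (reindex e e (fromBlocks 1 0 z 1 * fromBlocks (a • 1) y 0 D)) ∧
        (m = 0 ∨ ∀ c : F, D ≠ c • 1) := by
  obtain ⟨y, D, h⟩ := exists_isConj_fromBlocks_single e hA a
  set z : Matrix (Fin (m + 1)) (Fin 1) F := of fun i _ => if i = 0 then 1 else 0 with hz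
  by_cases hc : m = 0 ∨ ∀ c : F, D - a⁻¹ • (z * y) ≠ c • 1
  · exact ⟨y, _, _, by rwa [← fromBlocks_eq_lower_mul_upper ha], hc⟩
  push Not at hc
  obtain ⟨hm, c, hc⟩ := hc
  obtain ⟨m, rfl⟩ := Nat.exists_eq_succ_of_ne_zero hm
  have hc0 : c ≠ 0 := by
    rintro rfl
    obtain ⟨P, hP⟩ := h
    apply hdet
    rw [fromBlocks_eq_lower_mul_upper ha, hc] at hP
    have := congrArg det hP.eq
    rw [det_mul, det_mul, det_reindex_self, det_mul, det_fromBlocks_zero₂₁] at this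
    have hP := (isUnit_iff_isUnit_det _).1 P.isUnit
    simpa [det_fromBlocks_zero₂₁, hP.ne_zero] using this
  let t : Matrix (Fin 1) (Fin (m + 2)) F := of fun _ j => if j = 1 then 1 else 0
  have htz : t * z = 0 := by
    ext i j
    simp [t, z, mul_apply]
  have hzt : (z * t) 0 1 = 1 := by
    simp [t, z, mul_apply]
  have hD : D = c • 1 + a⁻¹ • (z * y) := by rw [← hc]; abel
  have htD : t * D = c • t := by
    rw [hD, Matrix.mul_add, Matrix.mul_smul, Matrix.mul_smul, ← Matrix.mul_assoc, htz]
    simp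
  have hconj : IsConj (fromBlocks (a • 1) y z D)
      (fromBlocks (a • 1) (a • t + y - c • t) z (z * t + D)) := by
    refine ⟨⟨fromBlocks 1 (-t) 0 1, fromBlocks 1 t 0 1, ?_, ?_⟩, ?_⟩
    · simp [fromBlocks_multiply]
    · simp [fromBlocks_multiply]
    · simp [SemiconjBy, fromBlocks_multiply, htz, htD]
      abel
  rw [fromBlocks_eq_lower_mul_upper ha (a • t + y - c • t)] at hconj
  refine ⟨_, _, _, h.trans (isConj_reindex e hconj), Or.inr fun x hx => ?_⟩
  have := congrFun (congrFun hx 0) 1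
  rw [hD] at this
  simp [Matrix.mul_add, Matrix.mul_sub, hzt] at this
  exact mul_ne_zero (inv_ne_zero ha) hc0 (by linear_combination this + inv_mul_cancel₀ ha)

theorem IsConj.exists_eq_mul {M : Type*} [Monoid M] {a b c : M} (h : IsConj a (b * c)) :
    ∃ b' c', IsConj b' b ∧ IsConj c' c ∧ a = b' * c' := by
  obtain ⟨p, hp⟩ := h
  refine ⟨p⁻¹.val * b * p.val, p⁻¹.val * c * p.val, ⟨p, by simp [SemiconjBy, mul_assoc]⟩,
    ⟨p, by simp [SemiconjBy, mul_assoc]⟩, ?_⟩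
  rw [← Units.inv_mul_cancel_left p a, hp.eq]
  simp [mul_assoc]

theorem isConj_reindex_diagonal {F ι κ : Type*} [Field F] [Fintype ι] [DecidableEq ι]
    [Fintype κ] [DecidableEq κ] (e : ι ≃ κ) {β : κ → F} {M : Matrix ι ι F}
    (h : IsConj M (diagonal (β ∘ e))) : IsConj (reindex e e M) (diagonal β) := by
  convert isConj_reindex e h
  simp [Function.comp_assoc]

theorem IsConj.det_eq {F κ : Type*} [Field F] [Fintype κ] [DecidableEq κ] {A B : Matrix κ κ F}
    (h : IsConj A B) : A.det = B.det :=
  isConj_iff_eq.1 (detMonoidHom.map_isConj h)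

/-- Sourour's factorization theorem, for distinct prescribed eigenvalues. -/
theorem exists_isConj_mul_of_ne_smul_one {F : Type*} [Field F] (n : ℕ) :
    ∀ (κ : Type) [Fintype κ] [DecidableEq κ] (A : Matrix κ κ F) (β γ : κ → F),
      Fintype.card κ = n → β.Injective → γ.Injective → (∀ i, β i ≠ 0) → (∀ i, γ i ≠ 0) →
      A.det = ∏ i, β i * γ i → (n = 1 ∨ ∀ c : F, A ≠ c • 1) →
      ∃ B C, IsConj B (diagonal β) ∧ IsConj C (diagonal γ) ∧ IsConj A (B * C) := by
  induction n with
  | zero =>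
    intro κ _ _ A β γ hκ _ _ _ _ _ h
    have := Fintype.card_eq_zero_iff.1 hκ
    simp only [zero_ne_one, false_or] at h
    exact (h 0 (Subsingleton.elim _ _)).elim
  | succ n ih =>
  intro κ _ _ A β γ hκ hβ hγ hβ0 hγ0 hdet h
  by_cases hn : n = 0
  · subst hn
    obtain ⟨_⟩ := Fintype.card_eq_one_iff_nonempty_unique.1 hκ
    refine ⟨_, _, .refl _, .refl _, ?_⟩
    convert IsConj.refl A
    ext i j
    obtain rfl := Subsingleton.elim i default
    obtain rfl := Subsingleton.elim j default
    rw [det_unique, Fintype.prod_unique] at hdet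
    simp [hdet]
  replace h := h.resolve_left (by omega)
  have hA0 : A.det ≠ 0 := by
    rw [hdet]
    exact Finset.prod_ne_zero_iff.2 fun i _ => mul_ne_zero (hβ0 i) (hγ0 i)
  obtain ⟨m, rfl⟩ := Nat.exists_eq_succ_of_ne_zero hn
  let e : Fin 1 ⊕ Fin (m + 1) ≃ κ := Fintype.equivOfCardEq (by simp; omega)
  set b := β (e (Sum.inl 0)) with hb
  set c := γ (e (Sum.inl 0)) with hc
  have hb0 : b ≠ 0 := hβ0 _
  have hc0 : c ≠ 0 := hγ0 _
  obtain ⟨y, z, D, hconj, hD⟩ := exists_isConj_lower_mul_upper e hA0 h (mul_ne_zero hb0 hc0)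
  have hdetD : D.det = ∏ i, β (e (Sum.inr i)) * γ (e (Sum.inr i)) := by
    apply mul_left_cancel₀ (mul_ne_zero hb0 hc0)
    rw [hconj.det_eq, det_reindex_self, det_mul, det_fromBlocks_zero₂₁, det_fromBlocks_zero₁₂,
      ← e.prod_comp, Fintype.prod_sum_type] at hdet
    simpa [-mul_eq_mul_left_iff] using hdet
  obtain ⟨B, C, hB, hC, hBC⟩ := ih (Fin (m + 1)) D (fun i => β (e (Sum.inr i)))
    (fun i => γ (e (Sum.inr i))) (by simp) (hβ.comp (e.injective.comp Sum.inr_injective))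
    (hγ.comp (e.injective.comp Sum.inr_injective)) (fun _ => hβ0 _) (fun _ => hγ0 _) hdetD
    (hD.imp_left (by omega))
  obtain ⟨B', C', hB', hC', rfl⟩ := hBC.exists_eq_mul
  refine ⟨reindex e e (fromBlocks (b • 1) 0 (b • z) B'),
    reindex e e (fromBlocks (c • 1) (b⁻¹ • y) 0 C'), isConj_reindex_diagonal e ?_,
    isConj_reindex_diagonal e ?_, ?_⟩
  · have := isConj_diagonal_fromBlocks_zero₁₂ (A := b • 1) (a := fun _ : Fin 1 => b) (b • z)
      (by rw [smul_one_eq_diagonal]) (hB'.trans hB) (fun i j h => by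
        simpa using e.injective (hβ h))
    convert this using 2
    ext (i | i)
    · simp [hb, Subsingleton.elim i 0]
    · simp
  · have := isConj_diagonal_fromBlocks_zero₂₁ (A := c • 1) (a := fun _ : Fin 1 => c) (b⁻¹ • y)
      (by rw [smul_one_eq_diagonal]) (hC'.trans hC) (fun i j h => by
        simpa using e.injective (hγ h))
    convert this using 2
    ext (i | i)
    · simp [hc, Subsingleton.elim i 0]
    · simp
  · convert hconj using 1
    rw [reindex_apply, reindex_apply, reindex_apply, submatrix_mul_equiv, fromBlocks_multiply,
      fromBlocks_multiply]
    simp [smul_smul, hb0, mul_comm c b]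

/-- A set is conjugation invariant if it is a union of conjugacy classes. -/
def ConjInvariant {M : Type*} [Monoid M] (S : Set M) : Prop :=
  ∀ ⦃g h : M⦄, IsConj g h → g ∈ S → h ∈ S

theorem ConjInvariant.mul {G : Type*} [Group G] {S T : Set G} (hS : ConjInvariant S)
    (hT : ConjInvariant T) : ConjInvariant (S * T) := by
  rintro _ h hc ⟨a, ha, b, hb, rfl⟩
  obtain ⟨c, rfl⟩ := isConj_iff.1 hc
  exact ⟨c * a * c⁻¹, hS (isConj_iff.2 ⟨c, rfl⟩) ha, c * b * c⁻¹, hT (isConj_iff.2 ⟨c, rfl⟩) hb,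
    conj_mul⟩

theorem ConjInvariant.pow {G : Type*} [Group G] {S : Set G} (hS : ConjInvariant S) (k : ℕ) :
    ConjInvariant (S ^ k) := by
  induction k with
  | zero =>
    rintro g h hc hg
    rw [pow_zero, Set.mem_one] at hg ⊢
    subst hg
    exact (isConj_one_right.1 hc)
  | succ k ih => rw [pow_succ]; exact ih.mul hS

section SpecialLinearGroup

variable {F κ : Type*} [Field F] [Fintype κ] [DecidableEq κ]

theorem Matrix.SpecialLinearGroup.isConj_of_isConj_coe [IsAlgClosed F]
    {g h : SpecialLinearGroup κ F} (hc : IsConj (g : Matrix κ κ F) (h : Matrix κ κ F)) :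
    IsConj g h := by
  cases isEmpty_or_nonempty κ
  · rw [Subsingleton.elim g h]
  obtain ⟨c, hc⟩ := hc
  have hc0 : c.val.det ≠ 0 := ((isUnit_iff_isUnit_det _).1 c.isUnit).ne_zero
  obtain ⟨μ, hμ⟩ := IsAlgClosed.exists_pow_nat_eq (c.val.det)⁻¹ (Fintype.card_pos (α := κ))
  let p : SpecialLinearGroup κ F := ⟨μ • c.val, by rw [det_smul, hμ, inv_mul_cancel₀ hc0]⟩
  refine isConj_iff.2 ⟨p, mul_inv_eq_of_eq_mul (Subtype.ext ?_)⟩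
  change (μ • c.val) * g.val = h.val * (μ • c.val)
  rw [Matrix.smul_mul, hc.eq, Matrix.mul_smul]

theorem ConjInvariant.mem_mul_of_isConj [IsAlgClosed F] {S T : Set (SpecialLinearGroup κ F)}
    (hS : ConjInvariant S) (hT : ConjInvariant T) {a b g : SpecialLinearGroup κ F} (ha : a ∈ S)
    (hb : b ∈ T) {A B : Matrix κ κ F} (hA : IsConj (a : Matrix κ κ F) A)
    (hB : IsConj (b : Matrix κ κ F) B) (hg : IsConj (A * B) (g : Matrix κ κ F)) :
    g ∈ S * T := by
  let A' : SpecialLinearGroup κ F := ⟨A, by rw [← hA.det_eq, a.det_coe]⟩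
  let B' : SpecialLinearGroup κ F := ⟨B, by rw [← hB.det_eq, b.det_coe]⟩
  refine hS.mul hT (g := A' * B')
    (Matrix.SpecialLinearGroup.isConj_of_isConj_coe (by simpa [A', B']))
    ⟨A', hS (Matrix.SpecialLinearGroup.isConj_of_isConj_coe hA) ha, B',
      hT (Matrix.SpecialLinearGroup.isConj_of_isConj_coe hB) hb, rfl⟩

end SpecialLinearGroup

theorem isConj_diagonal_comp {R κ : Type*} [CommRing R] [Fintype κ] [DecidableEq κ] (d : κ → R)
    (π : Equiv.Perm κ) : IsConj (diagonal (d ∘ π)) (diagonal d) := by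
  have h1 := (1 : Matrix κ κ R).submatrix_mul_equiv 1 π.symm (Equiv.refl _) π.symm
  refine ⟨⟨(1 : Matrix κ κ R).submatrix π.symm id, (1 : Matrix κ κ R).submatrix id π.symm,
    by simpa using h1, by simp⟩, ?_⟩
  rw [SemiconjBy, Units.val_mk]
  ext i j
  by_cases hij : π.symm i = j
  · subst hij
    simp [mul_diagonal, diagonal_mul, mul_comm]
  · simp [mul_diagonal, diagonal_mul, hij]

theorem exists_zpow_ne_one (F : Type*) [Field F] [Infinite F] (K : ℕ) :
    ∃ y : F, y ≠ 0 ∧ ∀ a : ℤ, |a| ≤ K → y ^ a = 1 → a = 0 := by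
  classical
  let p : Polynomial F := Polynomial.X * ∏ k ∈ Finset.Icc 1 K, (Polynomial.X ^ k - 1)
  have hp : p ≠ 0 := by
    refine mul_ne_zero Polynomial.X_ne_zero (Finset.prod_ne_zero_iff.2 fun k hk => ?_)
    exact Polynomial.X_pow_sub_C_ne_zero (by simp at hk; omega) 1
  obtain ⟨y, hy⟩ := Infinite.exists_notMem_finset p.roots.toFinset
  simp only [p, Multiset.mem_toFinset, Polynomial.mem_roots hp, Polynomial.IsRoot.def,
    Polynomial.eval_mul, Polynomial.eval_X, Polynomial.eval_prod, mul_eq_zero, not_or,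
    Finset.prod_eq_zero_iff, not_exists] at hy
  refine ⟨y, hy.1, fun a ha h => ?_⟩
  by_contra h0
  rw [Int.abs_eq_natAbs] at ha
  refine hy.2 a.natAbs ⟨by simp; omega, ?_⟩
  have : y ^ a.natAbs = 1 := by
    rcases Int.natAbs_eq a with h' | h'
    · rwa [h', zpow_natCast] at h
    · rwa [h', _root_.zpow_neg, inv_eq_one, zpow_natCast] at h
  simp [this]

/-- The vector with entries `y ^ m i` and `y ^ (-m i)` at `φ (i, 0)` and `φ (i, 1)`, and `1`
elsewhere. -/
noncomputable def torusVec {F ι κ : Type*} [Field F] (φ : ι × Fin 2 → κ) (y : F) (m : ι → ℤ) :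
    κ → F :=
  Function.extend φ (fun p => y ^ (if p.2 = 0 then m p.1 else -m p.1)) 1

section torusVec

variable {F ι κ : Type*} [Field F] {φ : ι × Fin 2 → κ} {y : F}

theorem torusVec_apply (hφ : φ.Injective) (m : ι → ℤ) (p : ι × Fin 2) :
    torusVec φ y m (φ p) = y ^ (if p.2 = 0 then m p.1 else -m p.1) :=
  hφ.extend_apply _ _ p

theorem torusVec_apply_of_notMem_range (m : ι → ℤ) {i : κ} (hi : i ∉ Set.range φ) :
    torusVec φ y m i = 1 :=
  Function.extend_apply' _ _ _ hi

theorem torusVec_zero (hφ : φ.Injective) : torusVec φ y 0 = 1 := by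
  ext i
  by_cases hi : i ∈ Set.range φ
  · obtain ⟨p, rfl⟩ := hi
    simp [torusVec_apply hφ]
  · simp [torusVec_apply_of_notMem_range 0 hi]

theorem torusVec_add (hφ : φ.Injective) (hy : y ≠ 0) (m m' : ι → ℤ) :
    torusVec φ y (m + m') = torusVec φ y m * torusVec φ y m' := by
  ext i
  by_cases hi : i ∈ Set.range φ
  · obtain ⟨p, rfl⟩ := hi
    rw [Pi.mul_apply, torusVec_apply hφ, torusVec_apply hφ, torusVec_apply hφ, ← zpow_add₀ hy]
    split_ifs <;> simp [add_comm]
  · simp [torusVec_apply_of_notMem_range _ hi]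

theorem torusVec_injective {n q : ℕ} (hq : n ≤ 2 * q + 1) {φ : Fin q × Fin 2 → Fin n}
    (hφ : φ.Injective) {y : F} (hy0 : y ≠ 0) {K : ℕ} (hK : q ≤ K)
    (hy : ∀ a : ℤ, |a| ≤ 2 * K → y ^ a = 1 → a = 0) :
    (torusVec φ y fun i => ((i : ℕ) : ℤ) + 1).Injective := by
  have hout (i j) (hi : i ∉ Set.range φ) (hj : j ∉ Set.range φ) : i = j := by
    have h1 : (Finset.univ.image φ).card = 2 * q := by
      rw [Finset.card_image_of_injective _ hφ]
      simp [mul_comm]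
    have h2 : ((Finset.univ.image φ)ᶜ).card ≤ 1 := by
      rw [Finset.card_compl, h1, Fintype.card_fin]
      omega
    exact Finset.card_le_one.1 h2 i (by simpa using hi) j (by simpa using hj)
  have hne (p) : torusVec φ y (fun i => ((i : ℕ) : ℤ) + 1) (φ p) ≠ 1 := by
    rw [torusVec_apply hφ]
    intro h
    have h1 := p.1.2
    have := hy _ (by split_ifs <;> rw [abs_le] <;> constructor <;> omega) h
    split_ifs at this <;> omega
  intro i j h
  by_cases hi : i ∈ Set.range φ
  · obtain ⟨⟨i, a⟩, rfl⟩ := hi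
    by_cases hj : j ∈ Set.range φ
    · obtain ⟨⟨j, b⟩, rfl⟩ := hj
      rw [torusVec_apply hφ, torusVec_apply hφ] at h
      rw [← div_eq_one_iff_eq (zpow_ne_zero _ hy0), ← zpow_sub₀ hy0] at h
      have h1 := i.2
      have h2 := j.2
      have h := hy _ (by dsimp only; split_ifs <;> rw [abs_le] <;> constructor <;> omega) h
      fin_cases a <;> fin_cases b <;> simp at h
      · rw [show i = j from Fin.ext (by omega)]
      · omega
      · omega
      · rw [show i = j from Fin.ext (by omega)]
    · rw [torusVec_apply_of_notMem_range _ hj] at h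
      exact (hne _ h).elim
  · by_cases hj : j ∈ Set.range φ
    · obtain ⟨p, rfl⟩ := hj
      rw [torusVec_apply_of_notMem_range _ hi] at h
      exact (hne _ h.symm).elim
    · exact hout i j hi hj

end torusVec

section Covering

variable {F : Type*} [Field F] [IsAlgClosed F] {n : ℕ}

theorem exists_mem_mul_eq_diagonal {R κ : Type*} [CommRing R] [Fintype κ] [DecidableEq κ]
    {S T : Set (SpecialLinearGroup κ R)} {a b : κ → R}
    (ha : ∃ g ∈ S, (g : Matrix κ κ R) = diagonal a)
    (hb : ∃ g ∈ T, (g : Matrix κ κ R) = diagonal b) :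
    ∃ g ∈ S * T, (g : Matrix κ κ R) = diagonal (a * b) := by
  obtain ⟨g, hg, ha⟩ := ha
  obtain ⟨h, hh, hb⟩ := hb
  refine ⟨g * h, Set.mul_mem_mul hg hh, (Matrix.SpecialLinearGroup.coe_mul g h).trans ?_⟩
  rw [ha, hb, diagonal_mul_diagonal]
  rfl

/-- There are `s` disjoint pairs of indices such that every diagonal matrix with distinct mutually
inverse entries `≠ 1` on each pair, and `1` elsewhere, is up to conjugation a product of two
conjugates of `u`. -/
def HasDiagonalPairs {κ : Type*} [Fintype κ] [DecidableEq κ] (u : Matrix κ κ F) (s : ℕ) : Prop :=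
  ∃ f : Fin s × Fin 2 → κ, f.Injective ∧
    ∀ x : Fin s × Fin 2 → F, x.Injective → (∀ p, x p ≠ 1) → (∀ k, x (k, 0) * x (k, 1) = 1) →
      ∀ d : κ → F, (∀ p, d (f p) = x p) → (∀ i ∉ Set.range f, d i = 1) →
        ∃ A B, IsConj u A ∧ IsConj u B ∧ IsConj (A * B) (diagonal d)

theorem diagonal_torusVec_mem_mul {s q : ℕ} {u : SpecialLinearGroup (Fin n) F}
    (hu : HasDiagonalPairs (u : Matrix (Fin n) (Fin n) F) s)
    {S : Set (SpecialLinearGroup (Fin n) F)} (hS : ConjInvariant S) (huS : u ∈ S)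
    {φ : Fin q × Fin 2 → Fin n} (hφ : φ.Injective) {y : F} (hy0 : y ≠ 0) {K : ℕ}
    (hy : ∀ a : ℤ, |a| ≤ 2 * K → y ^ a = 1 → a = 0) (T : Finset (Fin q)) (hT : T.card = s)
    (m : Fin q → ℤ) (hm0 : ∀ i ∉ T, m i = 0) (hmK : ∀ i, |m i| ≤ K)
    (hm : ∀ i ∈ T, ∀ j ∈ T, m i + m j ≠ 0 ∧ (m i = m j → i = j)) :
    ∃ g ∈ S * S, (g : Matrix (Fin n) (Fin n) F) = diagonal (torusVec φ y m) := by
  obtain ⟨f, hf, hu⟩ := hu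
  let σ := T.equivFinOfCardEq hT
  let g : Fin s × Fin 2 → Fin n := fun p => φ (σ.symm p.1, p.2)
  have hg : g.Injective := by
    rintro ⟨i, a⟩ ⟨j, b⟩ h
    simpa [Subtype.ext_iff] using hφ h
  obtain ⟨π, hπ⟩ := Equiv.Perm.exists_extending_pair f g hf hg
  set d := torusVec φ y m with hd
  have hdg (p) : d (g p) = y ^ (if p.2 = 0 then m (σ.symm p.1) else -m (σ.symm p.1)) :=
    torusVec_apply hφ _ _
  have hK (i) : -(K : ℤ) ≤ m i ∧ m i ≤ K := abs_le.1 (hmK i)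
  suffices h : ∃ A B, IsConj u.val A ∧ IsConj u.val B ∧ IsConj (A * B) (diagonal (d ∘ π)) by
    obtain ⟨A, B, hA, hB, hAB⟩ := h
    have h := hAB.trans (isConj_diagonal_comp d π)
    have hdet : (diagonal d).det = 1 := by
      rw [← h.det_eq, det_mul, ← hA.det_eq, ← hB.det_eq, u.det_coe, one_mul]
    exact ⟨⟨diagonal d, hdet⟩, hS.mem_mul_of_isConj hS huS huS hA hB h, rfl⟩
  refine hu (d ∘ g) ?_ ?_ ?_ (d ∘ π) ?_ ?_
  · rintro ⟨i, a⟩ ⟨j, b⟩ h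
    simp only [Function.comp_apply, hdg] at h
    have hi := (σ.symm i).2
    have hj := (σ.symm j).2
    have h1 := hm _ hi _ hj
    have h2 := hK (σ.symm i)
    have h3 := hK (σ.symm j)
    rw [← div_eq_one_iff_eq (zpow_ne_zero _ hy0), ← zpow_sub₀ hy0] at h
    have h := hy _ (by split_ifs <;> rw [abs_le] <;> constructor <;> omega) h
    fin_cases a <;> fin_cases b <;> simp at h
    · have := h1.2 (by omega)
      simpa [Subtype.ext_iff] using this
    · omega
    · omega
    · have := h1.2 (by omega)
      simpa [Subtype.ext_iff] using this
  · rintro ⟨i, a⟩ h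
    simp only [Function.comp_apply, hdg] at h
    have hi := (σ.symm i).2
    have h1 := hm _ hi _ hi
    have h2 := hK (σ.symm i)
    have h := hy _ (by split_ifs <;> rw [abs_le] <;> constructor <;> omega) h
    split_ifs at h <;> omega
  · intro k
    simp only [Function.comp_apply, hdg]
    simp [zpow_ne_zero, hy0]
  · intro p
    simp [hπ]
  · intro i hi
    by_cases h : π i ∈ Set.range φ
    · obtain ⟨⟨j, a⟩, h⟩ := h
      rw [Function.comp_apply, ← h, hd, torusVec_apply hφ]
      have : j ∉ T := by
        intro hj
        apply hi
        refine ⟨(σ ⟨j, hj⟩, a), π.injective ?_⟩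
        simp [hπ, g, h]
      simp [hm0 _ this]
    · exact torusVec_apply_of_notMem_range _ h

theorem diagonal_torusVec_mem_pow_four {s q : ℕ} {u : SpecialLinearGroup (Fin n) F}
    (hu : HasDiagonalPairs (u : Matrix (Fin n) (Fin n) F) s)
    {S : Set (SpecialLinearGroup (Fin n) F)} (hS : ConjInvariant S) (huS : u ∈ S)
    {φ : Fin q × Fin 2 → Fin n} (hφ : φ.Injective) {y : F} (hy0 : y ≠ 0)
    (hy : ∀ a : ℤ, |a| ≤ 2 * ((q + 1) ^ 2 : ℕ) → y ^ a = 1 → a = 0) (T : Finset (Fin q))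
    (hT : T.card = s) (m : Fin q → ℤ) (hm0 : ∀ i ∉ T, m i = 0) (hm : ∀ i, 0 ≤ m i ∧ m i ≤ q) :
    ∃ g ∈ S ^ 4, (g : Matrix (Fin n) (Fin n) F) = diagonal (torusVec φ y m) := by
  let w : Fin q → ℤ := fun i => if i ∈ T then (q + 1) * (i + 1) else 0
  have hw0 (i) (hi : i ∉ T) : w i = 0 := if_neg hi
  have hwT (i) (hi : i ∈ T) : w i = (q + 1) * (i + 1) := if_pos hi
  have hw (i) : 0 ≤ w i ∧ w i ≤ (q + 1) * q := by
    by_cases hi : i ∈ T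
    · rw [hwT i hi]
      have : ((i : ℕ) : ℤ) + 1 ≤ q := by exact_mod_cast i.2
      exact ⟨by positivity, by gcongr⟩
    · rw [hw0 i hi]
      exact ⟨le_rfl, by positivity⟩
  have hsep (i) (hi : i ∈ T) (j) (hj : j ∈ T) (h : w i + m i = w j + m j) : i = j := by
    have h1 := hm i
    have h2 := hm j
    rw [hwT i hi, hwT j hj] at h
    have : ((i : ℕ) : ℤ) = j := by nlinarith
    exact Fin.ext (by exact_mod_cast this)
  have hwpos (i) (hi : i ∈ T) : 0 < w i := by rw [hwT i hi]; positivity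
  have h1 := diagonal_torusVec_mem_mul hu hS huS hφ hy0 hy T hT (w + m)
    (fun i hi => by simp [hw0 i hi, hm0 i hi])
    (fun i => by
      have h1 := hw i
      have h2 := hm i
      rw [Pi.add_apply, abs_of_nonneg (by omega)]
      push_cast
      nlinarith)
    (fun i hi j hj => ⟨by
      have h1 := hwpos i hi
      have h2 := hwpos j hj
      have h3 := hm i
      have h4 := hm j
      simp only [Pi.add_apply]
      omega, hsep i hi j hj⟩)
  have h2 := diagonal_torusVec_mem_mul hu hS huS hφ hy0 hy T hT (-w)
    (fun i hi => by simp [hw0 i hi])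
    (fun i => by
      have h1 := hw i
      rw [Pi.neg_apply, abs_neg, abs_of_nonneg (by omega)]
      push_cast
      nlinarith)
    (fun i hi j hj => ⟨by
      have h1 := hwpos i hi
      have h2 := hwpos j hj
      simp only [Pi.neg_apply]
      omega, fun h => by
        rw [Pi.neg_apply, Pi.neg_apply, neg_inj, hwT i hi, hwT j hj] at h
        have := mul_left_cancel₀ (by positivity) h
        exact Fin.ext (by omega)⟩)
  have h3 := exists_mem_mul_eq_diagonal h1 h2
  rwa [← torusVec_add hφ hy0, show w + m + -w = m by abel, ← pow_two S, ← pow_two,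
    ← pow_mul] at h3

theorem diagonal_torusVec_mem_pow {s q : ℕ} (hsq : s ≤ q) {u : SpecialLinearGroup (Fin n) F}
    (hu : HasDiagonalPairs (u : Matrix (Fin n) (Fin n) F) s)
    {S : Set (SpecialLinearGroup (Fin n) F)} (hS : ConjInvariant S) (huS : u ∈ S)
    {φ : Fin q × Fin 2 → Fin n} (hφ : φ.Injective) {y : F} (hy0 : y ≠ 0)
    (hy : ∀ a : ℤ, |a| ≤ 2 * ((q + 1) ^ 2 : ℕ) → y ^ a = 1 → a = 0) (j : ℕ) :
    ∀ (m : Fin q → ℤ) (T : Finset (Fin q)), (∀ i ∉ T, m i = 0) → T.card ≤ j * s →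
      (∀ i, 0 ≤ m i ∧ m i ≤ q) →
      ∃ g ∈ S ^ (4 * j), (g : Matrix (Fin n) (Fin n) F) = diagonal (torusVec φ y m) := by
  induction j with
  | zero =>
    intro m T hm0 hT hm
    obtain rfl : T = ∅ := by simpa using hT
    obtain rfl : m = 0 := funext fun i => hm0 i (by simp)
    exact ⟨1, by simp, by simp [torusVec_zero hφ]⟩
  | succ j ih =>
    intro m T hm0 hT hm
    rw [add_mul, one_mul] at hT
    obtain ⟨T', hT', hsub⟩ : ∃ T' : Finset (Fin q), T'.card = s ∧ (T \ T').card ≤ j * s := by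
      by_cases h : s ≤ T.card
      · obtain ⟨T', h1, h2⟩ := Finset.exists_subset_card_eq h
        exact ⟨T', h2, by rw [Finset.card_sdiff_of_subset h1]; omega⟩
      · obtain ⟨T', h1, h2⟩ := Finset.exists_superset_card_eq (s := T) (by omega : T.card ≤ s)
          (by simpa using hsq)
        exact ⟨T', h2, by simp [Finset.sdiff_eq_empty_iff_subset.2 h1]⟩
    have h1 := ih (fun i => if i ∈ T' then 0 else m i) (T \ T')
      (fun i hi => by by_cases h : i ∈ T' <;> simp_all) hsub
      (fun i => by have := hm i; split_ifs <;> omega)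
    have h2 := diagonal_torusVec_mem_pow_four hu hS huS hφ hy0 hy T' hT'
      (fun i => if i ∈ T' then m i else 0) (fun i hi => by simp [hi])
      (fun i => by have := hm i; split_ifs <;> omega)
    have h3 := exists_mem_mul_eq_diagonal h1 h2
    rw [← torusVec_add hφ hy0, ← pow_add] at h3
    rwa [show m = (fun i => if i ∈ T' then 0 else m i) + fun i => if i ∈ T' then m i else 0 by
      ext i
      by_cases h : i ∈ T' <;> simp [h]]

theorem Matrix.SpecialLinearGroup.exists_ne_smul_one_inv_mul {R : Type*} [CommRing R]
    [Nontrivial R] {κ : Type*} [Fintype κ] [DecidableEq κ] [Nontrivial κ]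
    (g : SpecialLinearGroup κ R) :
    ∃ h : SpecialLinearGroup κ R, (∀ c : R, (h : Matrix κ κ R) ≠ c • 1) ∧
      ∀ c : R, ((h⁻¹ * g : SpecialLinearGroup κ R) : Matrix κ κ R) ≠ c • 1 := by
  obtain ⟨i, j, hij⟩ := exists_pair_ne κ
  let t (i j : κ) (hij : i ≠ j) : SpecialLinearGroup κ R :=
    ⟨Matrix.transvection i j 1, det_transvection_of_ne i j hij 1⟩
  have ht (i j hij) (c : R) : (t i j hij : Matrix κ κ R) ≠ c • 1 := fun h => by
    have := congrFun (congrFun h i) j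
    simp [t, Matrix.transvection, hij] at this
  have hg (i j hij) (c : R)
      (h : (((t i j hij)⁻¹ * g : SpecialLinearGroup κ R) : Matrix κ κ R) = c • 1) :
      (g : Matrix κ κ R) = c • Matrix.transvection i j 1 := by
    rw [← mul_inv_cancel_left (t i j hij) g, SpecialLinearGroup.coe_mul, h, Matrix.mul_smul,
      Matrix.mul_one]
  by_contra! H
  obtain ⟨c, hc⟩ := H (t i j hij) (ht i j hij)
  obtain ⟨c', hc'⟩ := H (t j i hij.symm) (ht j i hij.symm)
  replace hc := hg i j hij c hc
  replace hc' := hg j i hij.symm c' hc'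
  have h0 : c = 0 := by
    have := congrFun (congrFun (hc.symm.trans hc') i) j
    simpa [Matrix.transvection, hij, hij.symm] using this
  have hdet := g.det_coe
  rw [hc, h0, zero_smul, det_zero] at hdet
  exact zero_ne_one hdet

theorem pow_eq_univ_of_hasDiagonalPairs {s : ℕ} (hs : 1 ≤ s) (hsn : 2 * s ≤ n)
    {u : SpecialLinearGroup (Fin n) F}
    (hu : HasDiagonalPairs (u : Matrix (Fin n) (Fin n) F) s)
    {S : Set (SpecialLinearGroup (Fin n) F)} (hS : ConjInvariant S) (huS : u ∈ S) :
    S ^ (16 * (n / 2 / s + 1)) = Set.univ := by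
  set q := n / 2 with hq
  set j := q / s + 1 with hj
  obtain ⟨φ⟩ := Function.Embedding.nonempty_of_card_le (α := Fin q × Fin 2) (β := Fin n)
    (by simp; omega)
  obtain ⟨φ, hφ⟩ := φ
  have := IsAlgClosed.instInfinite (K := F)
  obtain ⟨y, hy0, hy⟩ := exists_zpow_ne_one F (2 * (q + 1) ^ 2)
  replace hy : ∀ a : ℤ, |a| ≤ 2 * ((q + 1) ^ 2 : ℕ) → y ^ a = 1 → a = 0 := by
    exact_mod_cast hy
  set d := torusVec φ y fun i => ((i : ℕ) : ℤ) + 1 with hd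
  have hdinj : d.Injective := torusVec_injective (by omega) hφ hy0 (by nlinarith) hy
  have hqs : q ≤ j * s := by
    have := Nat.lt_div_mul_add (a := q) (b := s) (by omega)
    rw [hj, add_mul]
    omega
  obtain ⟨D, hD, hDd⟩ := diagonal_torusVec_mem_pow (by omega) hu hS huS hφ hy0 hy j
    (fun i => ((i : ℕ) : ℤ) + 1) Finset.univ (by simp) (by simpa using hqs)
    (fun i => by have := i.2; omega)
  rw [← hd] at hDd
  have hprod : ∏ i, d i = 1 := by rw [← det_diagonal, ← hDd, D.det_coe]
  have hd0 (i) : d i ≠ 0 := Finset.prod_ne_zero_iff.1 (hprod ▸ one_ne_zero) i (Finset.mem_univ i)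
  have key (g : SpecialLinearGroup (Fin n) F)
      (hg : ∀ c : F, (g : Matrix (Fin n) (Fin n) F) ≠ c • 1) :
      g ∈ S ^ (4 * j) * S ^ (4 * j) := by
    obtain ⟨B, C, hB, hC, hBC⟩ := exists_isConj_mul_of_ne_smul_one n (Fin n) g.val d d (by simp)
      hdinj hdinj hd0 hd0 (by rw [g.det_coe, Finset.prod_mul_distrib, hprod, one_mul])
      (Or.inr hg)
    exact (hS.pow _).mem_mul_of_isConj (hS.pow _) hD hD (hDd ▸ hB.symm) (hDd ▸ hC.symm) hBC.symm
  have : Nontrivial (Fin n) := Fin.nontrivial_iff_two_le.2 (by omega)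
  refine Set.eq_univ_of_forall fun g => ?_
  obtain ⟨h, hh, hhg⟩ := g.exists_ne_smul_one_inv_mul
  have := Set.mul_mem_mul (key h hh) (key _ hhg)
  rw [mul_inv_cancel_left, ← pow_add, ← pow_add] at this
  convert this using 2
  omega

end Covering

section Commutant

theorem exists_mul_eq_zero_mulVec_injective {F κ : Type*} [Field F] [Fintype κ] [DecidableEq κ]
    (N : Matrix κ κ F) : ∃ P : Matrix κ (Fin (Fintype.card κ - N.rank)) F,
      N * P = 0 ∧ P.mulVec.Injective := by
  have hr : Module.finrank F (LinearMap.ker N.mulVecLin) = Fintype.card κ - N.rank := by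
    have := N.mulVecLin.finrank_range_add_finrank_ker
    rw [Module.finrank_fintype_fun_eq_card] at this
    rw [Matrix.rank]
    omega
  have b := Module.finBasisOfFinrankEq F _ hr
  refine ⟨(of fun a => (b a : κ → F))ᵀ, ?_, ?_⟩
  · ext i a
    have := (b a).2
    exact congrFun (LinearMap.mem_ker.1 this) i
  · rw [mulVec_injective_iff]
    have h := b.linearIndependent.map' (Submodule.subtype _) (Submodule.ker_subtype _)
    exact h

theorem eq_zero_of_mulVec_injective {R k l m : Type*} [CommRing R] [Fintype l] {P : Matrix k l R}
    (hP : P.mulVec.Injective) {X : Matrix l m R} (h : P * X = 0) : X = 0 := by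
  ext i j
  have : P *ᵥ (X.col j) = P *ᵥ 0 := by
    ext a
    rw [mulVec_zero]
    exact congrFun (congrFun h a) j
  exact congrFun (hP this) i

theorem mul_le_finrank_commutant {F κ : Type*} [Field F] [Fintype κ] [DecidableEq κ]
    {u : Matrix κ κ F} {k l : ℕ} {P : Matrix κ (Fin k) F} {Q : Matrix κ (Fin l) F}
    (hP : (u - 1) * P = 0) (hQ : (u - 1)ᵀ * Q = 0) (hPinj : P.mulVec.Injective)
    (hQinj : Q.mulVec.Injective) :
    k * l ≤ Module.finrank F
      (LinearMap.ker (LinearMap.mulRight F u - LinearMap.mulLeft F u)) := by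
  let Φ : Matrix (Fin k) (Fin l) F →ₗ[F] Matrix κ κ F :=
    { toFun := fun X => P * X * Qᵀ
      map_add' := fun X Y => by rw [Matrix.mul_add, Matrix.add_mul]
      map_smul' := fun c X => by rw [Matrix.mul_smul, Matrix.smul_mul, RingHom.id_apply] }
  have hmem (X) : Φ X ∈ LinearMap.ker (LinearMap.mulRight F u - LinearMap.mulLeft F u) := by
    have h1 : u * P = P := by rwa [Matrix.sub_mul, Matrix.one_mul, sub_eq_zero] at hP
    have h2 : Qᵀ * u = Qᵀ := by
      have := congrArg transpose hQ
      rwa [transpose_mul, transpose_transpose, Matrix.mul_sub, Matrix.mul_one, transpose_zero,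
        sub_eq_zero] at this
    rw [LinearMap.mem_ker, LinearMap.sub_apply, LinearMap.mulRight_apply,
      LinearMap.mulLeft_apply, sub_eq_zero]
    change P * X * Qᵀ * u = u * (P * X * Qᵀ)
    rw [Matrix.mul_assoc, h2, ← Matrix.mul_assoc, ← Matrix.mul_assoc, h1]
  have hΦ : Function.Injective (Φ.codRestrict _ hmem) := by
    rw [LinearMap.injective_codRestrict_iff, ← LinearMap.ker_eq_bot, LinearMap.ker_eq_bot']
    intro X hX
    change P * X * Qᵀ = 0 at hX
    rw [Matrix.mul_assoc] at hX
    have h := congrArg transpose (eq_zero_of_mulVec_injective hPinj hX)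
    rw [transpose_mul, transpose_transpose] at h
    simpa using eq_zero_of_mulVec_injective hQinj h
  simpa [Module.finrank_matrix] using LinearMap.finrank_le_finrank_of_injective hΦ

theorem sq_le_finrank_commutant {F κ : Type*} [Field F] [Fintype κ] [DecidableEq κ]
    (u : Matrix κ κ F) :
    (Fintype.card κ - (u - 1).rank) ^ 2 ≤ Module.finrank F
      (LinearMap.ker (LinearMap.mulRight F u - LinearMap.mulLeft F u)) := by
  obtain ⟨P, hP, hPinj⟩ := exists_mul_eq_zero_mulVec_injective (u - 1)
  obtain ⟨Q, hQ, hQinj⟩ := exists_mul_eq_zero_mulVec_injective (u - 1)ᵀ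
  have := mul_le_finrank_commutant hP hQ hPinj hQinj
  rwa [rank_transpose, ← pow_two] at this

end Commutant

/-- Paper's Theorem C for `SL_n(F)`: if `u ≠ 1` is unipotent and `d` is the
dimension of its commutant in `M_n(F)` (so `dim C = n² - d`), then some power
`C^k = SL_n(F)` with `k·(n² - d) ≤ 4608·(n² - 1)`. -/
theorem covering_number_dim_bound_SL {F : Type*} [Field F] [IsAlgClosed F]
    (n : ℕ) (hn : 2 ≤ n)
    (u : Matrix.SpecialLinearGroup (Fin n) F)
    (hu : ((u : Matrix (Fin n) (Fin n) F) - 1) ^ n = 0) (hu1 : u ≠ 1)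
    (d : ℕ)
    (hd : d = Module.finrank F
      (LinearMap.ker
        (LinearMap.mulRight F (u : Matrix (Fin n) (Fin n) F) -
          LinearMap.mulLeft F (u : Matrix (Fin n) (Fin n) F))))
    (C : Set (Matrix.SpecialLinearGroup (Fin n) F))
    (hC : C = {g | ∃ h : Matrix.SpecialLinearGroup (Fin n) F, g = h * u * h⁻¹}) :
    ∃ k : ℕ, 0 < k ∧ k * (n ^ 2 - d) ≤ 4608 * (n ^ 2 - 1) ∧ C ^ k = Set.univ := by
  obtain ⟨s, f, hf, hrank, hpairs⟩ :=
    exists_pairs_mul_isConj_diagonal n (Fin n) (u.val - 1) (by simp) ⟨n, hu⟩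
  have hu' : HasDiagonalPairs u.val s := ⟨f, hf, by simpa using hpairs⟩
  have hsn : 2 * s ≤ n := by
    simpa [mul_comm] using Fintype.card_le_of_injective f hf
  have hs : 1 ≤ s := by
    by_contra hs
    have h0 : (u.val - 1).rank = 0 := by omega
    rw [Matrix.rank, Submodule.finrank_eq_zero, LinearMap.range_eq_bot] at h0
    have h1 : u.val - 1 = 0 := toLin'.injective (h0.trans toLin'.map_zero.symm)
    exact hu1 (Subtype.ext (sub_eq_zero.1 h1))
  have hCconj : ConjInvariant C := by
    rintro g h hc hg
    rw [hC] at hg ⊢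
    obtain ⟨p, rfl⟩ := hg
    obtain ⟨q, rfl⟩ := isConj_iff.1 hc
    exact ⟨q * p, by group⟩
  have huC : u ∈ C := hC ▸ ⟨1, by simp⟩
  refine ⟨16 * (n / 2 / s + 1), by positivity, ?_,
    pow_eq_univ_of_hasDiagonalPairs hs hsn hu' hCconj huC⟩
  have hdim := sq_le_finrank_commutant u.val
  rw [← hd, Fintype.card_fin] at hdim
  have hrn : (u.val - 1).rank ≤ n := by simpa using (u.val - 1).rank_le_card_width
  have h1 : n ^ 2 - d ≤ 4 * n * s := by
    obtain ⟨t, ht⟩ := Nat.exists_eq_add_of_le hrn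
    rw [tsub_le_iff_right]
    have : n - (u.val - 1).rank = t := by omega
    rw [this] at hdim
    nlinarith
  have h2 : (n / 2 / s + 1) * s ≤ n := by
    have := Nat.div_mul_le_self (n / 2) s
    rw [add_mul]
    omega
  calc 16 * (n / 2 / s + 1) * (n ^ 2 - d) ≤ 16 * (n / 2 / s + 1) * (4 * n * s) := by gcongr
    _ = 64 * n * ((n / 2 / s + 1) * s) := by ring
    _ ≤ 64 * n * n := by gcongr
    _ ≤ 4608 * (n ^ 2 - 1) := by
      have : 4 ≤ n ^ 2 := by nlinarith
      rw [mul_assoc, ← pow_two]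
      omega
end

section
/- Let F be an algebraically closed field of characteristic different from 2, let n ≥ 1, and let Sp_{2n}(F) be the symplectic group of 2n×2n matrices M over F satisfying M·J·Mᵀ = J, where J is the standard symplectic form matrix [[0, I_n], [−I_n, 0]]. Let u ∈ Sp_{2n}(F) be a regular unipotent element, i.e., (u − 1)^{2n} = 0 and (u − 1)^{2n−1} ≠ 0 as matrices, and let C = {h u h⁻¹ : h ∈ Sp_{2n}(F)} be its conjugacy class in Sp_{2n}(F). Then C^4 = Sp_{2n}(F). -/
open Pointwise Matrix

theorem Polynomial.Splits.dvd_pow_of_forall_root {F : Type*} [Field F] {p f : Polynomial F}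
    (hp : p.Splits) (hp0 : p ≠ 0) (h : ∀ a ∈ p.roots, f.eval a = 0) :
    p ∣ f ^ Multiset.card p.roots := by
  have key : ∀ s : Multiset F, (∀ a ∈ s, f.eval a = 0) →
      (s.map fun a => Polynomial.X - Polynomial.C a).prod ∣ f ^ Multiset.card s := by
    intro s
    induction s using Multiset.induction with
    | empty => simp
    | cons a s ih =>
      intro hs
      rw [Multiset.map_cons, Multiset.prod_cons, Multiset.card_cons, pow_succ']
      exact mul_dvd_mul (Polynomial.dvd_iff_isRoot.2 (hs a (by simp)))
        (ih fun b hb => hs b (by simp [hb]))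
  rw [hp.eq_prod_roots]
  refine (IsUnit.mul_left_dvd (Polynomial.isUnit_C.2 (by simpa using hp0))).2 ?_
  simpa [← hp.eq_prod_roots] using key _ h

/-- Over an algebraically closed field of characteristic not two, an invertible matrix has a
square root which is a polynomial in it. -/
theorem Matrix.exists_sq_aeval_eq {F ι : Type*} [Field F] [IsAlgClosed F] [Fintype ι]
    [DecidableEq ι] (h2 : (2 : F) ≠ 0) (R : Matrix ι ι F) (hR : IsUnit R.det) :
    ∃ p : Polynomial F, (Polynomial.aeval R p) ^ 2 = R := by
  classical
  set χ := R.charpoly with hχ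
  have hχ0 : χ ≠ 0 := R.charpoly_monic.ne_zero
  have hc0 : χ.coeff 0 ≠ 0 := by
    intro h
    have := R.det_eq_sign_charpoly_coeff
    rw [← hχ, h, mul_zero] at this
    exact hR.ne_zero this
  have hroot : IsUnit (AdjoinRoot.root χ) := by
    obtain ⟨a, b, hab⟩ := (Polynomial.irreducible_X (R := F)).coprime_iff_not_dvd.2
      (mt Polynomial.X_dvd_iff.1 hc0)
    refine IsUnit.of_mul_eq_one (AdjoinRoot.mk χ a) ?_
    have := congrArg (AdjoinRoot.mk χ) hab
    simpa [mul_comm] using this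
  choose r hr using fun a : F => IsAlgClosed.exists_pow_nat_eq a (n := 2) (by norm_num)
  set s := Lagrange.interpolate χ.roots.toFinset id r with hs
  have hnil : IsNilpotent (AdjoinRoot.mk χ s ^ 2 - AdjoinRoot.root χ) := by
    refine ⟨Multiset.card χ.roots, ?_⟩
    rw [← AdjoinRoot.mk_X, ← map_pow, ← map_sub, ← map_pow, AdjoinRoot.mk_eq_zero]
    refine (IsAlgClosed.splits χ).dvd_pow_of_forall_root hχ0 fun a ha => ?_
    have := Lagrange.eval_interpolate_at_node (s := χ.roots.toFinset) (v := id) r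
      (Set.injOn_id _) (Multiset.mem_toFinset.2 ha)
    simp only [id] at this
    rw [Polynomial.eval_sub, Polynomial.eval_pow, hs, this, hr, Polynomial.eval_X, sub_self]
  have hunit : IsUnit (AdjoinRoot.mk χ s) := by
    have := hnil.isUnit_add_left_of_commute hroot (Commute.all _ _)
    rw [add_sub_cancel] at this
    exact (isUnit_pow_iff two_ne_zero).1 this
  have htwo : IsUnit (2 : AdjoinRoot χ) := by
    have := (IsUnit.mk0 _ h2).map (algebraMap F (AdjoinRoot χ))
    rwa [map_ofNat] at this
  obtain ⟨t, ⟨-, ht⟩, -⟩ := Polynomial.existsUnique_nilpotent_sub_and_aeval_eq_zero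
    (P := Polynomial.X ^ 2 - Polynomial.C (AdjoinRoot.root χ)) (x := AdjoinRoot.mk χ s)
    (by simpa using hnil) (by simpa [one_add_one_eq_two] using htwo.mul hunit)
  obtain ⟨p, rfl⟩ := AdjoinRoot.mk_surjective t
  refine ⟨p, ?_⟩
  have hdvd : χ ∣ p ^ 2 - Polynomial.X := by
    rw [← AdjoinRoot.mk_eq_zero]
    simpa using ht
  obtain ⟨c, hc⟩ := hdvd
  have := congrArg (Polynomial.aeval R) hc
  rw [map_mul, hχ, R.aeval_self_charpoly, zero_mul, map_sub, map_pow, Polynomial.aeval_X] at this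
  exact sub_eq_zero.1 this

theorem Matrix.mul_aeval_of_mul_eq_mul {F ι : Type*} [CommRing F] [Fintype ι] [DecidableEq ι]
    {A B T : Matrix ι ι F} (h : T * A = B * T) (p : Polynomial F) :
    T * Polynomial.aeval A p = Polynomial.aeval B p * T := by
  have hpow (k : ℕ) : T * A ^ k = B ^ k * T := SemiconjBy.pow_right h k
  induction p using Polynomial.induction_on' with
  | add p q hp hq => simp [mul_add, add_mul, hp, hq]
  | monomial k a => simp [← Polynomial.C_mul_X_pow_eq_monomial, ← Polynomial.smul_eq_C_mul, hpow]

theorem Matrix.aeval_transpose {F ι : Type*} [CommRing F] [Fintype ι] [DecidableEq ι]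
    (A : Matrix ι ι F) (p : Polynomial F) :
    Polynomial.aeval Aᵀ p = (Polynomial.aeval A p)ᵀ := by
  induction p using Polynomial.induction_on' with
  | add p q hp hq => simp [hp, hq]
  | monomial k a => simp [← Polynomial.C_mul_X_pow_eq_monomial, ← Polynomial.smul_eq_C_mul]

/-- Two symplectic matrices which are similar are conjugate in the symplectic group. -/
theorem SymplecticGroup.exists_conj_of_similar {F l : Type*} [Field F] [IsAlgClosed F] [Fintype l]
    [DecidableEq l] (h2 : (2 : F) ≠ 0) (u w : symplecticGroup l F)
    (P : Matrix (l ⊕ l) (l ⊕ l) F) (hP : IsUnit P.det) (h : w.1 * P = P * u.1) :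
    ∃ g : symplecticGroup l F, w = g * u * g⁻¹ := by
  have hu := SymplecticGroup.mem_iff'.1 u.2
  have hw := SymplecticGroup.mem_iff'.1 w.2
  have hJJ := J_squared l F
  set U := u.1 with hU
  set W := w.1 with hW
  set j := J l F with hj
  have hjT : jᵀ = -j := J_transpose l F
  have hUd : IsUnit U.det := SymplecticGroup.symplectic_det u.2
  have hjd : IsUnit j.det := isUnit_det_J l F
  set K := Pᵀ * j * P with hK
  set R := -j * K with hRdef
  have hjR : j * R = K := by
    rw [hRdef, neg_mul, mul_neg, ← mul_assoc, hJJ, neg_mul, neg_neg, one_mul]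
  have hKT : Kᵀ = -K := by simp [hK, hjT, mul_assoc]
  have hUK : Uᵀ * K * U = K := by
    have : Uᵀ * K * U = (P * U)ᵀ * j * (P * U) := by simp [hK, mul_assoc]
    rw [this, ← h, transpose_mul]
    calc Pᵀ * Wᵀ * j * (W * P) = Pᵀ * (Wᵀ * j * W) * P := by simp only [mul_assoc]
      _ = K := by rw [hw]
  have hRd : IsUnit R.det := by
    rw [hRdef, hK]
    simp only [det_mul, det_transpose, det_neg]
    exact (((isUnit_one.neg.pow _).mul hjd)).mul ((hP.mul hjd).mul hP)
  have hRU : R * U = U * R := by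
    have h1 : Uᵀ * (j * (R * U)) = Uᵀ * (j * (U * R)) := by
      calc Uᵀ * (j * (R * U)) = Uᵀ * (j * R) * U := by simp only [mul_assoc]
        _ = j * R := by rw [hjR, hUK]
        _ = (Uᵀ * j * U) * R := by rw [hu]
        _ = _ := by simp only [mul_assoc]
    have hUT : IsUnit Uᵀ := (isUnit_iff_isUnit_det _).2 (by rwa [det_transpose])
    exact ((isUnit_iff_isUnit_det _).2 hjd).mul_left_cancel (hUT.mul_left_cancel h1)
  have hRT : Rᵀ * j = j * R := by
    have : (j * R)ᵀ = -(j * R) := by rw [hjR, hKT]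
    rw [transpose_mul, hjT, mul_neg, neg_inj] at this
    exact this
  obtain ⟨p, hp⟩ := R.exists_sq_aeval_eq h2 hRd
  set S := Polynomial.aeval R p with hS
  have hSU : S * U = U * S := (mul_aeval_of_mul_eq_mul hRU.symm p).symm
  have hST : Sᵀ * j = j * S := by
    rw [hS, ← aeval_transpose, mul_aeval_of_mul_eq_mul hRT.symm]
  have hSd : IsUnit S.det := by
    have := congrArg det hp
    rw [det_pow] at this
    exact (isUnit_pow_iff two_ne_zero).1 (this ▸ hRd)
  have hSi : S⁻¹ * U = U * S⁻¹ := by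
    calc S⁻¹ * U = S⁻¹ * (U * S) * S⁻¹ := by
          rw [mul_assoc, mul_assoc, mul_nonsing_inv _ hSd, mul_one]
      _ = U * S⁻¹ := by rw [← hSU, ← mul_assoc S⁻¹, nonsing_inv_mul _ hSd, one_mul]
  have hmem : P * S⁻¹ ∈ symplecticGroup l F := by
    rw [SymplecticGroup.mem_iff', ← hj, transpose_mul]
    have : Sᵀ * j * S = K := by rw [hST, mul_assoc, ← sq, hp, hjR]
    have hSS : S * S⁻¹ = 1 := mul_nonsing_inv _ hSd
    calc S⁻¹ᵀ * Pᵀ * j * (P * S⁻¹) = S⁻¹ᵀ * K * S⁻¹ := by simp only [hK, mul_assoc]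
      _ = (S * S⁻¹)ᵀ * j * (S * S⁻¹) := by rw [← this, transpose_mul]; simp only [mul_assoc]
      _ = j := by simp [hSS]
  refine ⟨⟨_, hmem⟩, eq_mul_inv_of_mul_eq (Subtype.ext ?_)⟩
  change W * (P * S⁻¹) = P * S⁻¹ * U
  rw [← mul_assoc, h, mul_assoc, mul_assoc, hSi]

/-- A nilpotent matrix of maximal nilpotency index is similar to a shift. -/
theorem Matrix.exists_mul_eq_mul_shift {F ι : Type*} [Field F] [Fintype ι] [DecidableEq ι] {k : ℕ}
    (e : ι ≃ Fin k) (N : Matrix ι ι F) (hN : N ^ k = 0) (hN' : N ^ (k - 1) ≠ 0) :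
    ∃ Q : Matrix ι ι F, IsUnit Q.det ∧
      N * Q = Q * of fun i j => if (e i : ℕ) = e j + 1 then 1 else 0 := by
  obtain ⟨v, hv⟩ : ∃ v, N ^ (k - 1) *ᵥ v ≠ 0 := by
    by_contra! h
    exact hN' (Matrix.ext_of_mulVec_single fun i => by rw [h, zero_mulVec])
  have hzero (a : ℕ) (ha : k ≤ a) : N ^ a = 0 := pow_eq_zero_of_le ha hN
  set Q : Matrix ι ι F := of fun i j => (N ^ (e j : ℕ) *ᵥ v) i with hQ
  have hQc (c : ι → F) : Q *ᵥ c = ∑ j, c j • (N ^ (e j : ℕ) *ᵥ v) := by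
    ext i
    simp [hQ, mulVec, dotProduct, mul_comm]
  refine ⟨Q, ?_, ?_⟩
  · rw [← isUnit_iff_isUnit_det, ← mulVec_injective_iff_isUnit]
    refine (injective_iff_map_eq_zero (mulVecLin Q)).2 fun c hc => ?_
    rw [mulVecLin_apply, hQc] at hc
    have key : ∀ m : ℕ, ∀ j, (e j : ℕ) = m → c j = 0 := by
      intro m
      induction m using Nat.strong_induction_on with
      | _ m ih =>
        intro j hj
        have h1 := congrArg (fun x => N ^ (k - 1 - m) *ᵥ x) hc
        simp only [mulVec_zero, mulVec_sum, mulVec_smul, mulVec_mulVec, ← pow_add] at h1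
        rw [Finset.sum_eq_single j] at h1
        · have : k - 1 - m + (e j : ℕ) = k - 1 := by have := (e j).2; omega
          rw [this] at h1
          exact (smul_eq_zero.1 h1).resolve_right hv
        · intro i _ hij
          rcases lt_trichotomy (e i : ℕ) m with h | h | h
          · rw [ih _ h i rfl, zero_smul]
          · exact absurd (e.injective (Fin.ext (h.trans hj.symm))) hij
          · rw [hzero _ (by omega), zero_mulVec, smul_zero]
        · simp
    exact funext fun j => key _ j rfl
  · ext i j
    have hl : (N * Q) i j = (N ^ ((e j : ℕ) + 1) *ᵥ v) i := by
      rw [pow_succ', ← mulVec_mulVec]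
      simp [mul_apply, hQ, mulVec, dotProduct]
    rw [hl, mul_apply]
    by_cases h : (e j : ℕ) + 1 < k
    · rw [Finset.sum_eq_single (e.symm ⟨_, h⟩)]
      · simp [hQ]
      · intro b _ hb
        have : (e b : ℕ) ≠ e j + 1 := fun h' => hb (by rw [Equiv.eq_symm_apply]; exact Fin.ext h')
        simp [this]
      · simp
    · rw [hzero _ (by omega), Finset.sum_eq_zero]
      · simp
      · intro b _
        have : (e b : ℕ) ≠ e j + 1 := by have := (e b).2; omega
        simp [this]

/-- A `2n × 2n` matrix is regular unipotent if it is unipotent with a single Jordan block. -/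
def IsRegularUnipotent {F : Type*} [Field F] {n : ℕ}
    (M : Matrix (Fin n ⊕ Fin n) (Fin n ⊕ Fin n) F) : Prop :=
  (M - 1) ^ (2 * n) = 0 ∧ (M - 1) ^ (2 * n - 1) ≠ 0

namespace IsRegularUnipotent

variable {F : Type*} [Field F] {n : ℕ}

theorem exists_similar {M M' : Matrix (Fin n ⊕ Fin n) (Fin n ⊕ Fin n) F}
    (h : IsRegularUnipotent M) (h' : IsRegularUnipotent M') :
    ∃ P : Matrix (Fin n ⊕ Fin n) (Fin n ⊕ Fin n) F, IsUnit P.det ∧ M' * P = P * M := by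
  let e : Fin n ⊕ Fin n ≃ Fin (2 * n) := finSumFinEquiv.trans (finCongr (two_mul n).symm)
  obtain ⟨Q, hQ, hQM⟩ := exists_mul_eq_mul_shift e _ h.1 h.2
  obtain ⟨Q', hQ', hQM'⟩ := exists_mul_eq_mul_shift e _ h'.1 h'.2
  refine ⟨Q' * Q⁻¹, ?_, sub_eq_zero.1 ?_⟩
  · rw [det_mul]
    exact hQ'.mul (isUnit_nonsing_inv_det _ hQ)
  · set S : Matrix (Fin n ⊕ Fin n) (Fin n ⊕ Fin n) F :=
      of fun i j => if (e i : ℕ) = e j + 1 then 1 else 0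
    have h1 : (M' - 1) * (Q' * Q⁻¹) = Q' * Q⁻¹ * (M - 1) := by
      calc (M' - 1) * (Q' * Q⁻¹) = Q' * (S * (Q⁻¹ * Q)) * Q⁻¹ := by
            rw [← mul_assoc, hQM', nonsing_inv_mul _ hQ, mul_one]
        _ = Q' * Q⁻¹ * ((M - 1) * (Q * Q⁻¹)) := by
          rw [nonsing_inv_mul _ hQ, mul_one, ← mul_assoc (M - 1), hQM]
          simp only [← mul_assoc]
          rw [mul_assoc Q' Q⁻¹ Q, nonsing_inv_mul _ hQ, mul_one]
        _ = _ := by rw [mul_nonsing_inv _ hQ, mul_one]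
    rw [sub_mul, mul_sub, mul_one, one_mul] at h1
    simpa using sub_eq_zero.2 h1

theorem transpose {M : Matrix (Fin n ⊕ Fin n) (Fin n ⊕ Fin n) F} (h : IsRegularUnipotent M) :
    IsRegularUnipotent Mᵀ := by
  have (k : ℕ) : (Mᵀ - 1) ^ k = ((M - 1) ^ k)ᵀ := by
    rw [transpose_pow, transpose_sub, transpose_one]
  exact ⟨by rw [this, h.1, transpose_zero], fun h0 => h.2 (by
    rwa [this, transpose_eq_zero] at h0)⟩

theorem fromBlocks {m : ℕ} {A Y D : Matrix (Fin (m + 1)) (Fin (m + 1)) F}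
    (hA : (A - 1) ^ (m + 1) = 0) (hD : (D - 1) ^ (m + 1) = 0)
    (hY : (A - 1) ^ m * Y * (D - 1) ^ m ≠ 0) : IsRegularUnipotent (fromBlocks A Y 0 D) := by
  have h1 : Matrix.fromBlocks A Y 0 D - 1 = Matrix.fromBlocks (A - 1) Y 0 (D - 1) := by
    rw [← fromBlocks_one, sub_eq_add_neg, fromBlocks_neg, fromBlocks_add]
    simp [sub_eq_add_neg]
  have hpow (k : ℕ) : ∃ Z, Matrix.fromBlocks (A - 1) Y 0 (D - 1) ^ k =
      Matrix.fromBlocks ((A - 1) ^ k) Z 0 ((D - 1) ^ k) := by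
    induction k with
    | zero => exact ⟨0, by simp⟩
    | succ k ih =>
      obtain ⟨Z, hZ⟩ := ih
      exact ⟨(A - 1) ^ k * Y + Z * (D - 1), by
        rw [pow_succ, hZ, fromBlocks_multiply]; simp [pow_succ]⟩
  obtain ⟨Z, hZ⟩ := hpow m
  have hZ' : Matrix.fromBlocks (A - 1) Y 0 (D - 1) ^ (m + 1) =
      Matrix.fromBlocks 0 ((A - 1) * Z + Y * (D - 1) ^ m) 0 0 := by
    rw [pow_succ', hZ, fromBlocks_multiply]
    simp [← pow_succ', hA, hD]
  rw [IsRegularUnipotent, h1]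
  constructor
  · rw [show 2 * (m + 1) = (m + 1) + (m + 1) by ring, pow_add, hZ', fromBlocks_multiply]
    simp
  · rw [show 2 * (m + 1) - 1 = m + (m + 1) by omega, pow_add, hZ', hZ, fromBlocks_multiply]
    intro h
    rw [← fromBlocks_zero, fromBlocks_inj] at h
    apply hY
    simpa [mul_add, ← mul_assoc, ← pow_succ, hA] using h.2.1

end IsRegularUnipotent

/-- For `Y` symmetric and nonzero, the quadratic form of `Y` is nonzero at a vector with
`k`-th coordinate one. -/
theorem Matrix.IsSymm.exists_dotProduct_mulVec_ne_zero {F ι : Type*} [Field F] [Fintype ι]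
    [DecidableEq ι] (h2 : (2 : F) ≠ 0) {Y : Matrix ι ι F} (hY : Y.IsSymm) (hY0 : Y ≠ 0) (k : ι) :
    ∃ c : ι → F, c k = 0 ∧ (Pi.single k 1 + c) ⬝ᵥ Y *ᵥ (Pi.single k 1 + c) ≠ 0 := by
  by_contra! h
  have hs (v w : ι → F) : v ⬝ᵥ Y *ᵥ w = w ⬝ᵥ Y *ᵥ v := by
    rw [dotProduct_comm v, dotProduct_mulVec, ← mulVec_transpose, hY.eq]
  have hk : Pi.single k 1 ⬝ᵥ Y *ᵥ Pi.single k 1 = 0 := by simpa using h 0 rfl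
  have hc (c : ι → F) (hc : c k = 0) :
      Pi.single k 1 ⬝ᵥ Y *ᵥ c = 0 ∧ c ⬝ᵥ Y *ᵥ c = 0 := by
    have e1 := h c hc
    have e2 := h (-c) (by simp [hc])
    simp only [mulVec_add, mulVec_neg, dotProduct_add, add_dotProduct, neg_dotProduct,
      dotProduct_neg, hk, hs c (Pi.single k 1)] at e1 e2
    constructor
    · apply mul_left_cancel₀ (mul_ne_zero h2 h2)
      linear_combination e1 - e2
    · apply mul_left_cancel₀ h2
      linear_combination e1 + e2
  have hcd (c d : ι → F) (hc' : c k = 0) (hd : d k = 0) : c ⬝ᵥ Y *ᵥ d = 0 := by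
    have e1 := (hc (c + d) (by simp [hc', hd])).2
    simp only [mulVec_add, dotProduct_add, add_dotProduct, (hc c hc').2, (hc d hd).2, hs d c] at e1
    apply mul_left_cancel₀ h2
    linear_combination e1
  apply hY0
  ext i j
  have hij : Y i j = Pi.single i 1 ⬝ᵥ Y *ᵥ Pi.single j 1 := by simp
  rw [hij, zero_apply]
  have hsk (i : ι) (hi : i ≠ k) : (Pi.single i 1 : ι → F) k = 0 := by simp [hi.symm]
  rcases eq_or_ne i k with rfl | hi <;> rcases eq_or_ne j i with rfl | hj
  · exact hk
  · exact (hc _ (hsk _ hj)).1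
  · exact (hc _ (hsk _ hi)).2
  · rcases eq_or_ne j k with rfl | hj'
    · rw [hs]
      exact (hc _ (hsk _ hi)).1
    · exact hcd _ _ (hsk _ hi) (hsk _ hj')

theorem exists_quadratic_ne_zero {F : Type*} [Field F] [Infinite F] (a b c a' b' c' : F)
    (h : a + b + c ≠ 0) (h' : a' ≠ 0) :
    ∃ t : F, a + b * t + c * t ^ 2 ≠ 0 ∧ a' + b' * t + c' * t ^ 2 ≠ 0 := by
  open Polynomial in
  let p : F[X] := C a + C b * X + C c * X ^ 2
  let q : F[X] := C a' + C b' * X + C c' * X ^ 2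
  have hp : p ≠ 0 := fun hp => h (by simpa [p] using congrArg (eval 1) hp)
  have hq : q ≠ 0 := fun hq => h' (by simpa [q] using congrArg (eval 0) hq)
  obtain ⟨t, ht⟩ : ∃ t, (p * q).eval t ≠ 0 := by
    by_contra! h0
    exact mul_ne_zero hp hq (Polynomial.funext (by simpa using h0))
  rw [eval_mul] at ht
  exact ⟨t, by simpa [p] using left_ne_zero_of_mul ht, by simpa [q] using right_ne_zero_of_mul ht⟩

/-- Two nonzero symmetric forms on a space and its dual are nonzero on suitable extremal vectors
of a pair of dual bases. -/
theorem Matrix.exists_congr_apply_ne_zero {F ι : Type*} [Field F] [Infinite F] [Fintype ι]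
    [DecidableEq ι] (h2 : (2 : F) ≠ 0) {X Y : Matrix ι ι F} (hX : X.IsSymm) (hX0 : X ≠ 0)
    (hY : Y.IsSymm) (hY0 : Y ≠ 0) (i j : ι) :
    ∃ P Q : Matrix ι ι F, P * Q = 1 ∧ (P * X * Pᵀ) j j ≠ 0 ∧ (Qᵀ * Y * Q) i i ≠ 0 := by
  have hrow (P X : Matrix ι ι F) (j : ι) : (P * X * Pᵀ) j j = P j ⬝ᵥ X *ᵥ P j := by
    rw [dotProduct_mulVec]
    rfl
  obtain ⟨c, hc, hcX⟩ := hX.exists_dotProduct_mulVec_ne_zero h2 hX0 j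
  set P₁ : Matrix ι ι F := 1 + vecMulVec (Pi.single j 1) c with hP₁
  set Q₁ : Matrix ι ι F := 1 - vecMulVec (Pi.single j 1) c with hQ₁
  have hvv : vecMulVec (Pi.single j 1) c * vecMulVec (Pi.single j 1) c = 0 := by
    simp [vecMulVec_mul_vecMulVec, hc]
  have hPQ₁ : P₁ * Q₁ = 1 := by
    rw [hP₁, hQ₁, add_mul, mul_sub, mul_sub, hvv]; simp
  have hQP₁ : Q₁ * P₁ = 1 := mul_eq_one_comm.1 hPQ₁
  set X' := P₁ * X * P₁ᵀ with hX'
  have hX'j : X' j j ≠ 0 := by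
    rw [hX', hrow]
    have hrw : P₁ j = Pi.single j 1 + c := by
      ext k
      simp [hP₁, vecMulVec_apply, one_apply, Pi.single_apply, eq_comm]
    rwa [hrw]
  set Y' := Q₁ᵀ * Y * Q₁ with hY'
  have hY's : Y'.IsSymm := by
    simp [hY', Matrix.IsSymm, hY.eq, mul_assoc]
  have hY'0 : Y' ≠ 0 := by
    intro h
    apply hY0
    calc Y = (Q₁ * P₁)ᵀ * Y * (Q₁ * P₁) := by simp [hQP₁]
      _ = P₁ᵀ * Y' * P₁ := by simp only [hY', transpose_mul, mul_assoc]
      _ = 0 := by simp [h]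
  obtain ⟨d, hd, hdY⟩ := hY's.exists_dotProduct_mulVec_ne_zero h2 hY'0 i
  have hvv' : vecMulVec d (Pi.single i 1) * vecMulVec d (Pi.single i 1) = 0 := by
    simp [vecMulVec_mul_vecMulVec, hd]
  obtain ⟨t, ht1, ht2⟩ := exists_quadratic_ne_zero (Y' i i)
    (Pi.single i 1 ⬝ᵥ Y' *ᵥ d + d ⬝ᵥ Y' *ᵥ Pi.single i 1) (d ⬝ᵥ Y' *ᵥ d)
    (X' j j) (-d j * (X' i j + X' j i)) (d j ^ 2 * X' i i)
    (by
      simp only [mulVec_add, dotProduct_add, add_dotProduct] at hdY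
      convert hdY using 1
      simp; ring) hX'j
  set P₂ : Matrix ι ι F := 1 - t • vecMulVec d (Pi.single i 1) with hP₂
  set Q₂ : Matrix ι ι F := 1 + t • vecMulVec d (Pi.single i 1) with hQ₂
  refine ⟨P₂ * P₁, Q₁ * Q₂, ?_, ?_, ?_⟩
  · have : P₂ * Q₂ = 1 := by
      rw [hP₂, hQ₂, sub_mul, mul_add, mul_add]; simp [hvv']
    calc P₂ * P₁ * (Q₁ * Q₂) = P₂ * (P₁ * Q₁) * Q₂ := by simp only [mul_assoc]
      _ = 1 := by rw [hPQ₁, mul_one, this]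
  · have : P₂ * P₁ * X * (P₂ * P₁)ᵀ = P₂ * X' * P₂ᵀ := by
      simp only [hX', transpose_mul, mul_assoc]
    rw [this, hrow]
    have hrw : P₂ j = Pi.single j 1 - (t * d j) • Pi.single i 1 := by
      ext k; simp [hP₂, vecMulVec_apply, one_apply, Pi.single_apply, eq_comm]
    rw [hrw]
    convert ht2 using 1
    simp [mulVec_sub, mulVec_smul]; ring
  · have : (Q₁ * Q₂)ᵀ * Y * (Q₁ * Q₂) = Q₂ᵀ * Y' * Q₂ᵀᵀ := by
      simp only [hY', transpose_mul, mul_assoc, transpose_transpose]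
    rw [this, hrow]
    have hrw : Q₂ᵀ i = Pi.single i 1 + t • d := by
      ext k; simp [hQ₂, vecMulVec_apply, one_apply, Pi.single_apply, eq_comm]
    rw [hrw]
    convert ht1 using 1
    simp [mulVec_add, mulVec_smul]; ring

theorem Matrix.upperShift_pow_apply {R : Type*} [Semiring R] {n : ℕ} (k : ℕ) (i j : Fin n) :
    ((of fun i j : Fin n => if (i : ℕ) + 1 = j then (1 : R) else 0) ^ k) i j =
      if (i : ℕ) + k = j then 1 else 0 := by
  induction k generalizing i j with
  | zero => simp [one_apply, Fin.ext_iff]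
  | succ k ih =>
    rw [pow_succ, mul_apply]
    simp only [ih, of_apply, ite_mul, one_mul, zero_mul]
    by_cases h : (i : ℕ) + k < n
    · rw [Finset.sum_eq_single ⟨i + k, h⟩]
      · simp [add_assoc]
      · intro b _ hb
        rw [if_neg fun h' => hb (Fin.ext h'.symm)]
      · simp
    · rw [Finset.sum_eq_zero fun x _ => if_neg (by have := x.2; omega), if_neg (by omega)]

namespace SymplecticGroup

theorem exists_isRegularUnipotent_mul_eq_of_apply_ne_zero {F : Type*} [Field F] {m : ℕ}
    {X Y : Matrix (Fin (m + 1)) (Fin (m + 1)) F} (hX : X.IsSymm) (hY : Y.IsSymm)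
    (hX0 : X (Fin.last m) (Fin.last m) ≠ 0) (hY0 : Y 0 0 ≠ 0) :
    ∃ w w' : symplecticGroup (Fin (m + 1)) F, IsRegularUnipotent w.1 ∧ IsRegularUnipotent w'.1 ∧
      w.1 * w'.1 = fromBlocks (1 + X * Y) X Y 1 := by
  set N : Matrix (Fin (m + 1)) (Fin (m + 1)) F :=
    of fun i j => if (i : ℕ) + 1 = j then 1 else 0 with hN
  have hN0 : N ^ (m + 1) = 0 := by
    ext i j
    rw [hN, upperShift_pow_apply, if_neg (by omega), Matrix.zero_apply]
  have hE : N ^ m = single 0 (Fin.last m) 1 := by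
    ext i j
    rw [hN, upperShift_pow_apply, single_apply]
    congr 1
    simp only [Fin.ext_iff, Fin.val_zero, Fin.val_last, eq_iff_iff]
    omega
  set E := N ^ m with hE'
  have hNE : N * E = 0 := by rw [hE', ← pow_succ', hN0]
  have hEN : E * N = 0 := by rw [hE', ← pow_succ, hN0]
  obtain ⟨A, hA⟩ : ∃ A, A = 1 + N := ⟨_, rfl⟩
  obtain ⟨B, hBA, hAB⟩ : ∃ B, B * A = 1 ∧ A * B = 1 := by
    have : IsUnit A := hA ▸ IsNilpotent.isUnit_one_add ⟨_, hN0⟩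
    exact ⟨A⁻¹, nonsing_inv_mul _ ((isUnit_iff_isUnit_det _).1 this),
      mul_nonsing_inv _ ((isUnit_iff_isUnit_det _).1 this)⟩
  have hAE : A * E = E := by rw [hA, add_mul, one_mul, hNE, add_zero]
  have hEA : E * A = E := by rw [hA, mul_add, mul_one, hEN, add_zero]
  have hBE : B * E = E := by rw [← hAE, ← mul_assoc, hBA, one_mul, hAE]
  have hEB : E * B = E := by rw [← hEA, mul_assoc, hAB, mul_one, hEA]
  have hA1 : A - 1 = N := by rw [hA, add_sub_cancel_left]
  have hB1 : B - 1 = -(B * N) := by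
    rw [← hA1, mul_sub, hBA, mul_one, neg_sub]
  have hcomm : Commute B N := by
    rw [← hA1]
    exact Commute.sub_right (hBA.trans hAB.symm) (Commute.one_right _)
  have hBkE (k : ℕ) : B ^ k * E = E := by
    induction k with
    | zero => simp
    | succ k ih => rw [pow_succ, mul_assoc, hBE, ih]
  have hBm : (B - 1) ^ m = (-1) ^ m * E := by
    rw [hB1, neg_pow, hcomm.mul_pow, hBkE]
  have hBm1 : (B - 1) ^ (m + 1) = 0 := by
    rw [hB1, neg_pow, hcomm.mul_pow, hN0, mul_zero, mul_zero]
  have hBT (k : ℕ) : (Bᵀ - 1) ^ k = ((B - 1) ^ k)ᵀ := by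
    rw [transpose_pow, transpose_sub, transpose_one]
  have hsign : ((-1 : Matrix (Fin (m + 1)) (Fin (m + 1)) F) ^ m)ᵀ = (-1) ^ m := by
    simp [transpose_pow]
  have hu : IsUnit ((-1 : Matrix (Fin (m + 1)) (Fin (m + 1)) F) ^ m) := isUnit_one.neg.pow m
  have hEE : N ^ m = E := rfl
  have hABt : Bᵀ * Aᵀ = 1 := by rw [← transpose_mul, hAB, transpose_one]
  have hBAt : Aᵀ * Bᵀ = 1 := by rw [← transpose_mul, hBA, transpose_one]
  refine ⟨⟨fromBlocks A (X * Bᵀ) 0 Bᵀ, ?_⟩, ⟨fromBlocks B 0 (Aᵀ * Y) Aᵀ, ?_⟩, ?_, ?_, ?_⟩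
  · rw [SymplecticGroup.fromBlocks_mem_iff]
    simp [hBAt, hX.eq, mul_assoc]
  · rw [SymplecticGroup.fromBlocks_mem_iff]
    simp [hABt, hY.eq, ← mul_assoc]
    rw [mul_assoc, hAB, mul_one]
  · refine IsRegularUnipotent.fromBlocks (by rw [hA1, hN0])
      (by rw [hBT, hBm1, transpose_zero]) ?_
    rw [hBT, hBm, hA1, hEE, transpose_mul, hsign]
    intro h
    rw [← mul_assoc, hu.mul_left_eq_zero, mul_assoc, mul_assoc, ← transpose_mul, hEB] at h
    apply hX0
    simpa [hE] using congrFun (congrFun h 0) 0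
  · have : (fromBlocks B 0 (Aᵀ * Y) Aᵀ) = (fromBlocks Bᵀ (Y * A) 0 A)ᵀ := by
      rw [fromBlocks_transpose]; simp [hY.eq]
    simp only [this]
    refine (IsRegularUnipotent.fromBlocks (by rw [hBT, hBm1, transpose_zero])
      (by rw [hA1, hN0]) ?_).transpose
    rw [hBT, hBm, hA1, hEE, transpose_mul, hsign, ← ((Commute.neg_one_left Eᵀ).pow_left m).eq]
    intro h
    rw [mul_assoc, mul_assoc, mul_assoc, hAE, hu.mul_right_eq_zero] at h
    apply hY0
    simpa [hE] using congrFun (congrFun h (Fin.last m)) (Fin.last m)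
  · rw [fromBlocks_multiply]
    simp only [hAB, ← mul_assoc, hABt, mul_zero, zero_mul, zero_add, one_mul]
    rw [mul_assoc X, hABt, mul_one]

end SymplecticGroup

theorem AdjoinRoot.exists_nondegenerate_functional {F : Type*} [Field F] {g : Polynomial F}
    (hgm : g.Monic) :
    ∃ ε : AdjoinRoot g →ₗ[F] F, ∀ x, (∀ y, ε (x * y) = 0) → x = 0 := by
  refine ⟨(Polynomial.lcoeff F (g.natDegree - 1)).comp (AdjoinRoot.modByMonicHom hgm),
    fun x hx => ?_⟩
  obtain ⟨p, rfl⟩ := AdjoinRoot.mk_surjective (g := g) x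
  set r := p %ₘ g with hr
  have hpr : AdjoinRoot.mk g p = AdjoinRoot.mk g r :=
    AdjoinRoot.mk_eq_mk.2 ⟨p /ₘ g, by
      linear_combination -(Polynomial.modByMonic_add_div p g)⟩
  by_contra hne
  have hr0 : r ≠ 0 := fun h => hne (by rw [hpr, h, map_zero])
  have hdeg : r.degree < g.degree := Polynomial.degree_modByMonic_lt p hgm
  have hnat : r.natDegree < g.natDegree := Polynomial.natDegree_lt_natDegree hr0 hdeg
  have h := hx (AdjoinRoot.mk g (Polynomial.X ^ (g.natDegree - 1 - r.natDegree)))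
  rw [hpr, ← map_mul, LinearMap.comp_apply, AdjoinRoot.modByMonicHom_mk,
    (Polynomial.modByMonic_eq_self_iff hgm).2, Polynomial.lcoeff_apply,
    Polynomial.coeff_mul_X_pow', if_pos (by omega)] at h
  · rw [show g.natDegree - 1 - (g.natDegree - 1 - r.natDegree) = r.natDegree by omega] at h
    exact hr0 (Polynomial.leadingCoeff_eq_zero.1 h)
  · rw [Polynomial.degree_mul, Polynomial.degree_X_pow, Polynomial.degree_eq_natDegree hr0,
      Polynomial.degree_eq_natDegree hgm.ne_zero]
    norm_cast
    omega

/-- The quotient of `F[X]` by a nonzero polynomial is a Frobenius algebra. -/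
theorem Polynomial.exists_nondegenerate_functional {F : Type*} [Field F] {q : Polynomial F}
    (hq : q ≠ 0) :
    ∃ ε : (Polynomial F ⧸ Ideal.span {q}) →ₗ[F] F,
      ∀ x, (∀ y, ε (x * y) = 0) → x = 0 := by
  rw [(Ideal.span_singleton_mul_right_unit
    (Polynomial.isUnit_C.2 (by simpa using hq : IsUnit q.leadingCoeff⁻¹)) q).symm]
  exact AdjoinRoot.exists_nondegenerate_functional (Polynomial.monic_mul_leadingCoeff_inv hq)

/-- The Taussky–Zassenhaus theorem: a square matrix over a field is similar to its transpose by
a symmetric matrix. -/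
theorem Matrix.exists_isSymm_mul_eq_transpose_mul {F ι : Type*} [Field F] [Fintype ι]
    [DecidableEq ι] (D : Matrix ι ι F) :
    ∃ S : Matrix ι ι F, S.IsSymm ∧ IsUnit S.det ∧ S * D = Dᵀ * S := by
  classical
  set φ := toLin' D with hφ
  have htors : Module.IsTorsion (Polynomial F) (Module.AEval' φ) :=
    Module.AEval.isTorsion_of_finiteDimensional F (ι → F) φ
  obtain ⟨κ, _, p, hp, e, ⟨Φ⟩⟩ := Module.equiv_directSum_of_isTorsion htors
  choose ε hε using fun i : κ =>
    Polynomial.exists_nondegenerate_functional (pow_ne_zero (e i) (hp i).ne_zero)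
  let Ψ : (ι → F) →ₗ[F] (i : κ) → (Polynomial F ⧸ Ideal.span {p i ^ e i}) :=
    { toFun := fun v i => Φ (Module.AEval'.of φ v) i
      map_add' := fun v w => by ext i; simp
      map_smul' := fun c v => by
        ext i
        rw [map_smul, ← Module.AEval.C_smul, map_smul, DirectSum.smul_apply,
          ← Polynomial.algebraMap_eq, algebraMap_smul]
        rfl }
  have hΨ (v i) : Ψ v i = Φ (Module.AEval'.of φ v) i := rfl
  have hΨinj : ∀ v, Ψ v = 0 → v = 0 := fun v hv => by
    have : Φ (Module.AEval'.of φ v) = 0 := DFinsupp.ext fun i => congrFun hv i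
    simpa using this
  have hΨsurj : Function.Surjective Ψ := fun y => by
    refine ⟨(Module.AEval'.of φ).symm (Φ.symm (DFinsupp.equivFunOnFintype.symm y)), ?_⟩
    ext i
    rw [hΨ, LinearEquiv.apply_symm_apply, LinearEquiv.apply_symm_apply]
    rfl
  have hΨX (v) : Ψ (D *ᵥ v) = fun i => Ideal.Quotient.mk _ Polynomial.X * Ψ v i := by
    ext i
    rw [hΨ, hΨ, ← toLin'_apply, ← Module.AEval'.X_smul_of, map_smul, DirectSum.smul_apply]
    rfl
  have hsmul (c : F) (v i) : Ψ (c • v) i = c • Ψ v i := by rw [map_smul]; rfl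
  let b : (ι → F) → (ι → F) → F := fun v w => ∑ i, ε i (Ψ v i * Ψ w i)
  let B : LinearMap.BilinForm F (ι → F) := LinearMap.mk₂ F b
    (by simp [b, add_mul, Finset.sum_add_distrib])
    (by intro c v w; simp only [b, hsmul, smul_mul_assoc, map_smul, Finset.smul_sum])
    (by simp [b, mul_add, Finset.sum_add_distrib])
    (by intro c v w; simp only [b, hsmul, mul_smul_comm, map_smul, Finset.smul_sum])
  have hB (v w) : B v w = ∑ i, ε i (Ψ v i * Ψ w i) := rfl
  have hBS (v w) : B v w = v ⬝ᵥ LinearMap.toMatrix₂' F B *ᵥ w := by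
    rw [← toLinearMap₂'_apply', toLinearMap₂'_toMatrix']
  refine ⟨LinearMap.toMatrix₂' F B, ?_, ?_, ?_⟩
  · ext i j
    simp [hB, mul_comm]
  · rw [← isUnit_iff_isUnit_det, ← mulVec_injective_iff_isUnit]
    refine (injective_iff_map_eq_zero (mulVecLin _)).2 fun w hw => ?_
    rw [mulVecLin_apply] at hw
    refine hΨinj w (funext fun i => hε i _ fun y => ?_)
    obtain ⟨v, hv⟩ := hΨsurj (Pi.single i y)
    have := hBS v w
    rw [hw, dotProduct_zero, hB, hv, Finset.sum_eq_single i] at this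
    · simpa [mul_comm] using this
    · intro j _ hj
      simp [hj]
    · simp
  · ext i j
    have h1 := hBS (Pi.single i 1) (D *ᵥ Pi.single j 1)
    have h2 := hBS (D *ᵥ Pi.single i 1) (Pi.single j 1)
    have h3 : B (Pi.single i 1) (D *ᵥ Pi.single j 1) = B (D *ᵥ Pi.single i 1) (Pi.single j 1) := by
      simp only [hB, hΨX]
      exact Finset.sum_congr rfl fun i _ => by congr 1; ring
    rw [h1, h2, mulVec_mulVec, ← vecMul_transpose D, ← dotProduct_mulVec, mulVec_mulVec] at h3
    simpa using h3

namespace IsRegularUnipotent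

variable {F : Type*} [Field F] {n : ℕ}

theorem conj {w : symplecticGroup (Fin n) F} (hw : IsRegularUnipotent w.1)
    (g : symplecticGroup (Fin n) F) : IsRegularUnipotent (g * w * g⁻¹).1 := by
  have hg : g.1 * (g⁻¹).1 = 1 := congrArg Subtype.val (mul_inv_cancel g)
  have hg' : (g⁻¹).1 * g.1 = 1 := congrArg Subtype.val (inv_mul_cancel g)
  have hsemi (k : ℕ) : g.1 * (w.1 - 1) ^ k = ((g * w * g⁻¹).1 - 1) ^ k * g.1 := by
    refine SemiconjBy.pow_right (show g.1 * (w.1 - 1) = (g.1 * w.1 * (g⁻¹).1 - 1) * g.1 from ?_) k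
    rw [sub_mul, mul_assoc, hg', mul_one, mul_sub, mul_one, one_mul]
  constructor
  · have h := hsemi (2 * n)
    rw [hw.1, mul_zero] at h
    exact ((IsUnit.of_mul_eq_one _ hg).mul_left_eq_zero).1 h.symm
  · intro h
    have h' := hsemi (2 * n - 1)
    rw [h, zero_mul] at h'
    exact hw.2 (((IsUnit.of_mul_eq_one _ hg).mul_right_eq_zero).1 h')

theorem inv {w : symplecticGroup (Fin n) F} (hw : IsRegularUnipotent w.1) :
    IsRegularUnipotent (w⁻¹).1 := by
  have h1 : (w⁻¹).1 * w.1 = 1 := congrArg Subtype.val (inv_mul_cancel w)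
  have h2 : w.1 * (w⁻¹).1 = 1 := congrArg Subtype.val (mul_inv_cancel w)
  have hpow (k : ℕ) : w.1 ^ k * ((w⁻¹).1 - 1) ^ k = (-1) ^ k * (w.1 - 1) ^ k := by
    rw [← Commute.mul_pow, mul_sub, h2, mul_one, ← neg_pow, neg_sub]
    exact Commute.sub_right (h2.trans h1.symm) (Commute.one_right _)
  have hw' (k : ℕ) : IsUnit (w.1 ^ k) := (IsUnit.of_mul_eq_one _ h2).pow k
  have hu (k : ℕ) : IsUnit ((-1 : Matrix (Fin n ⊕ Fin n) (Fin n ⊕ Fin n) F) ^ k) :=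
    isUnit_one.neg.pow k
  constructor
  · rw [← (hw' _).mul_right_eq_zero, hpow, hw.1, mul_zero]
  · rw [Ne, ← (hw' (2 * n - 1)).mul_right_eq_zero, hpow, (hu _).mul_right_eq_zero]
    exact hw.2

end IsRegularUnipotent

theorem Matrix.exists_isSymm_isUnit_det_add_mul {F ι : Type*} [Field F] [Fintype ι]
    [DecidableEq ι] {A C : Matrix ι ι F} (hAC : Aᵀ * C = Cᵀ * A)
    (hker : ∀ x, A *ᵥ x = 0 → C *ᵥ x = 0 → x = 0) :
    ∃ Z : Matrix ι ι F, Z.IsSymm ∧ IsUnit (A + Z * C).det := by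
  induction hd : Module.finrank F (LinearMap.ker A.mulVecLin) using Nat.strong_induction_on
    generalizing A with
  | _ d ih =>
  by_cases hinj : ∀ x, A *ᵥ x = 0 → x = 0
  · refine ⟨0, isSymm_zero, ?_⟩
    rw [zero_mul, add_zero, ← isUnit_iff_isUnit_det, ← mulVec_injective_iff_isUnit]
    exact (injective_iff_map_eq_zero (mulVecLin A)).2 hinj
  push Not at hinj
  obtain ⟨x, hx, hx0⟩ := hinj
  obtain ⟨k, hk⟩ : ∃ k, (C *ᵥ x) k ≠ 0 := by
    by_contra! h
    exact hx0 (hker x hx (funext h))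
  have hE (y : ι → F) : (A + single k k 1 * C) *ᵥ y = A *ᵥ y + Pi.single k ((C *ᵥ y) k) := by
    rw [add_mulVec, ← mulVec_mulVec]
    congr 1
    ext i
    simp [mulVec, dotProduct, single_apply, Pi.single_apply, ite_and, eq_comm]
  have hcA (y : ι → F) : (C *ᵥ x) ⬝ᵥ A *ᵥ y = 0 := by
    rw [dotProduct_mulVec, ← mulVec_transpose, mulVec_mulVec, hAC, ← mulVec_mulVec, hx,
      mulVec_zero, zero_dotProduct]
  have hker' (y : ι → F) (hy : (A + single k k 1 * C) *ᵥ y = 0) :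
      (C *ᵥ y) k = 0 ∧ A *ᵥ y = 0 := by
    rw [hE] at hy
    have h := congrArg (fun z => (C *ᵥ x) ⬝ᵥ z) hy
    simp only [dotProduct_add, hcA, zero_add, dotProduct_zero, dotProduct_single,
      mul_eq_zero, hk, false_or] at h
    refine ⟨h, ?_⟩
    rwa [h, Pi.single_zero, add_zero] at hy
  obtain ⟨Z, hZ, hdet⟩ := ih _ (hd ▸ Submodule.finrank_lt_finrank_of_lt
      (SetLike.lt_iff_le_and_exists.2 ⟨fun y hy => (hker' y hy).2, x, hx,
        fun h => hk (hker' x h).1⟩))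
    (A := A + single k k 1 * C) (by simp [add_mul, mul_add, hAC, mul_assoc])
    (fun y hy => hker y (hker' y hy).2) rfl
  refine ⟨single k k 1 + Z, IsSymm.add (by simp [IsSymm]) hZ, ?_⟩
  rwa [add_mul, ← add_assoc]

theorem Matrix.exists_ne_zero_isUnit_det_one_add_smul {F ι : Type*} [Field F] [Infinite F]
    [Fintype ι] [DecidableEq ι] (B : Matrix ι ι F) :
    ∃ c : F, c ≠ 0 ∧ IsUnit (1 + c • B).det := by
  classical
  obtain ⟨a, ha⟩ := Infinite.exists_notMem_finset (insert 0 (-B).charpoly.roots.toFinset)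
  simp only [Finset.mem_insert, Multiset.mem_toFinset, not_or,
    Polynomial.mem_roots (-B).charpoly_monic.ne_zero, Polynomial.IsRoot.def, eval_charpoly,
    sub_neg_eq_add] at ha
  refine ⟨a⁻¹, inv_ne_zero ha.1, ?_⟩
  rw [show 1 + a⁻¹ • B = a⁻¹ • (scalar ι a + B) by
    rw [smul_add, scalar_apply, ← smul_one_eq_diagonal, smul_smul, inv_mul_cancel₀ ha.1,
      one_smul], det_smul]
  exact (IsUnit.mk0 _ (pow_ne_zero _ (inv_ne_zero ha.1))).mul (IsUnit.mk0 _ ha.2)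

namespace SymplecticGroup

section

variable {R l : Type*} [CommRing R] [Fintype l] [DecidableEq l]

theorem exists_coe_eq_fromBlocks_upper {X : Matrix l l R} (hX : X.IsSymm) :
    ∃ t : symplecticGroup l R, t.1 = fromBlocks 1 X 0 1 ∧ (t⁻¹).1 = fromBlocks 1 (-X) 0 1 := by
  refine ⟨⟨fromBlocks 1 X 0 1, fromBlocks_mem_iff.2 (by simp [hX.eq])⟩, rfl, ?_⟩
  rw [inv_eq_of_mul_eq_one_right (b := ⟨fromBlocks 1 (-X) 0 1,
    fromBlocks_mem_iff.2 (by simp [hX.eq])⟩) (Subtype.ext (by simp [fromBlocks_multiply]))]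

theorem exists_coe_eq_fromBlocks_lower {X : Matrix l l R} (hX : X.IsSymm) :
    ∃ t : symplecticGroup l R, t.1 = fromBlocks 1 0 X 1 ∧ (t⁻¹).1 = fromBlocks 1 0 (-X) 1 := by
  refine ⟨⟨fromBlocks 1 0 X 1, fromBlocks_mem_iff.2 (by simp [hX.eq])⟩, rfl, ?_⟩
  rw [inv_eq_of_mul_eq_one_right (b := ⟨fromBlocks 1 0 (-X) 1,
    fromBlocks_mem_iff.2 (by simp [hX.eq])⟩) (Subtype.ext (by simp [fromBlocks_multiply]))]

theorem exists_coe_eq_fromBlocks_mul {X Y : Matrix l l R} (hX : X.IsSymm) (hY : Y.IsSymm) :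
    ∃ t : symplecticGroup l R, t.1 = fromBlocks (1 + X * Y) X Y 1 := by
  obtain ⟨t, ht, -⟩ := exists_coe_eq_fromBlocks_upper hX
  obtain ⟨s, hs, -⟩ := exists_coe_eq_fromBlocks_lower hY
  exact ⟨t * s, by simp [ht, hs, fromBlocks_multiply]⟩

end

theorem exists_conj_isUnit_det_toBlocks₂₂ {F l : Type*} [Field F] [Infinite F] [Fintype l]
    [DecidableEq l] {g : symplecticGroup l F} (hg : g ≠ 1) :
    ∃ t : symplecticGroup l F, IsUnit (t * g * t⁻¹).1.toBlocks₂₂.det ∧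
      (t * g * t⁻¹).1.toBlocks₂₂ ≠ 1 := by
  have hblocks (g : symplecticGroup l F) : ∃ A B C D, g.1 = fromBlocks A B C D :=
    ⟨_, _, _, _, (fromBlocks_toBlocks g.1).symm⟩
  obtain ⟨t, ht⟩ : ∃ t : symplecticGroup l F, IsUnit (t * g * t⁻¹).1.toBlocks₂₂.det := by
    obtain ⟨A, B, C, D, h⟩ := hblocks g
    obtain ⟨-, h2, h3⟩ := fromBlocks_mem_iff.1 (h ▸ g.2)
    obtain ⟨Z, hZ, hdet⟩ := exists_isSymm_isUnit_det_add_mul h2.symm fun x hx hx' => by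
      have := congrArg (· *ᵥ x) h3
      simpa [sub_mulVec, ← mulVec_mulVec, hx, hx'] using this.symm
    obtain ⟨t, ht, ht'⟩ := exists_coe_eq_fromBlocks_lower hZ
    exact ⟨t, by simpa [ht, ht', h, fromBlocks_multiply, add_comm] using hdet⟩
  by_cases h1 : (t * g * t⁻¹).1.toBlocks₂₂ = 1
  swap
  · exact ⟨t, ht, h1⟩
  have hconj (s : symplecticGroup l F) : s * t * g * (s * t)⁻¹ = s * (t * g * t⁻¹) * s⁻¹ := by
    group
  have hg'1 : t * g * t⁻¹ ≠ 1 := by rwa [Ne, conj_eq_one_iff]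
  generalize t * g * t⁻¹ = g' at h1 hg'1 hconj
  suffices ∃ s : symplecticGroup l F, IsUnit (s * g' * s⁻¹).1.toBlocks₂₂.det ∧
      (s * g' * s⁻¹).1.toBlocks₂₂ ≠ 1 by
    obtain ⟨s, hs⟩ := this
    exact ⟨s * t, by rwa [hconj]⟩
  obtain ⟨A, B, C, D, h⟩ := hblocks g'
  obtain rfl : D = 1 := by simpa [h] using h1
  by_cases hB : B = 0
  · subst hB
    obtain ⟨-, -, h3⟩ := fromBlocks_mem_iff.1 (h ▸ g'.2)
    obtain rfl : A = 1 := by simpa using h3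
    have hC : C ≠ 0 := by
      rintro rfl
      exact hg'1 (Subtype.ext (by rw [h, fromBlocks_one]; rfl))
    obtain ⟨c, hc, hdet⟩ := exists_ne_zero_isUnit_det_one_add_smul (-C)
    obtain ⟨s, hs, hs'⟩ := exists_coe_eq_fromBlocks_upper
      (X := c • (1 : Matrix l l F)) (by simp [IsSymm])
    have : (s * g' * s⁻¹).1.toBlocks₂₂ = 1 + c • (-C) := by
      simp [hs, hs', h, fromBlocks_multiply, add_comm]
    exact ⟨s, by rwa [this], by rw [this]; simp [hc, hC]⟩
  · obtain ⟨c, hc, hdet⟩ := exists_ne_zero_isUnit_det_one_add_smul B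
    obtain ⟨s, hs, hs'⟩ := exists_coe_eq_fromBlocks_lower
      (X := c • (1 : Matrix l l F)) (by simp [IsSymm])
    have : (s * g' * s⁻¹).1.toBlocks₂₂ = 1 + c • B := by
      simp [hs, hs', h, fromBlocks_multiply, add_comm]
    exact ⟨s, by rwa [this], by rw [this]; simp [hc, hB]⟩

theorem mem_isRegularUnipotent_mul {F : Type*} [Field F] [Infinite F] (h2 : (2 : F) ≠ 0) {m : ℕ}
    {X Y : Matrix (Fin (m + 1)) (Fin (m + 1)) F} (hX : X.IsSymm) (hX0 : X ≠ 0) (hY : Y.IsSymm)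
    (hY0 : Y ≠ 0) {g : symplecticGroup (Fin (m + 1)) F}
    (hg : g.1 = fromBlocks (1 + X * Y) X Y 1) :
    g ∈ {w : symplecticGroup (Fin (m + 1)) F | IsRegularUnipotent w.1} *
      {w : symplecticGroup (Fin (m + 1)) F | IsRegularUnipotent w.1} := by
  obtain ⟨P, Q, hPQ, hX1, hY1⟩ := exists_congr_apply_ne_zero h2 hX hX0 hY hY0 0 (Fin.last m)
  have hQP : Q * P = 1 := mul_eq_one_comm.1 hPQ
  have hPQt : Pᵀ * Qᵀ = 1 := by rw [← transpose_mul, hQP, transpose_one]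
  obtain ⟨w, w', hw, hw', h⟩ := exists_isRegularUnipotent_mul_eq_of_apply_ne_zero
    (X := P * X * Pᵀ) (Y := Qᵀ * Y * Q) (by simp [IsSymm, hX.eq, mul_assoc])
    (by simp [IsSymm, hY.eq, mul_assoc]) hX1 hY1
  let t : symplecticGroup (Fin (m + 1)) F :=
    ⟨fromBlocks P 0 0 Qᵀ, fromBlocks_mem_iff.2 (by simp [hPQt])⟩
  have ht : t * g = w * w' * t := by
    refine Subtype.ext ?_
    change fromBlocks P 0 0 Qᵀ * g.1 = w.1 * w'.1 * fromBlocks P 0 0 Qᵀ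
    rw [h, hg, fromBlocks_multiply, fromBlocks_multiply]
    congr 1
    · simp only [zero_mul, mul_zero, add_zero, mul_add, add_mul, mul_one, one_mul, mul_assoc, hQP]
      rw [← mul_assoc Pᵀ, hPQt, one_mul]
    · simp [mul_assoc, hPQt]
    · simp [mul_assoc, hQP]
    · simp
  refine Set.mem_mul.2 ⟨t⁻¹ * w * t⁻¹⁻¹, hw.conj _, t⁻¹ * w' * t⁻¹⁻¹, hw'.conj _, ?_⟩
  rw [eq_inv_mul_of_mul_eq ht]
  group

theorem exists_isSymm_eq_mul {F l : Type*} [Field F] [Infinite F] [Fintype l] [Nonempty l]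
    [DecidableEq l] {A B C D : Matrix l l F} (h : fromBlocks A B C D ∈ symplecticGroup l F)
    (hD : IsUnit D.det) (hD1 : D ≠ 1) :
    ∃ X₁ Y₁ X₂ Y₂ : Matrix l l F, (X₁.IsSymm ∧ X₁ ≠ 0) ∧ (Y₁.IsSymm ∧ Y₁ ≠ 0) ∧
      (X₂.IsSymm ∧ X₂ ≠ 0) ∧ (Y₂.IsSymm ∧ Y₂ ≠ 0) ∧
      fromBlocks A B C D =
        fromBlocks (1 + X₁ * Y₁) X₁ Y₁ 1 * fromBlocks (1 + X₂ * Y₂) X₂ Y₂ 1 := by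
  obtain ⟨E, hDE, hED⟩ : ∃ E, D * E = 1 ∧ E * D = 1 :=
    ⟨D⁻¹, mul_nonsing_inv _ hD, nonsing_inv_mul _ hD⟩
  have hE0 {M : Matrix l l F} (hM : M ≠ 0) : E * M ≠ 0 := fun h0 => hM (by
    rw [← one_mul M, ← hDE, mul_assoc, h0, mul_zero])
  have hE1 : 1 - E ≠ 0 := fun h0 => hD1 (by
    rw [← hDE, ← sub_eq_zero.1 h0, mul_one])
  have hEt : Eᵀ * Dᵀ = 1 := by rw [← transpose_mul, hDE, transpose_one]
  have hEt' : Dᵀ * Eᵀ = 1 := by rw [← transpose_mul, hED, transpose_one]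
  obtain ⟨-, hBD, -⟩ := fromBlocks_mem_iff.1 h
  obtain ⟨-, hCD, hAD⟩ := fromBlocks_mem_iff.1
    (by simpa [fromBlocks_transpose] using transpose_mem h)
  simp only [transpose_transpose] at hCD hAD
  have hBE : (B * E).IsSymm := by
    rw [IsSymm, transpose_mul]
    calc Eᵀ * Bᵀ = Eᵀ * (Bᵀ * D) * E := by rw [mul_assoc, mul_assoc, hDE, mul_one]
      _ = B * E := by rw [hBD, ← mul_assoc, hEt, one_mul]
  have hEC : (E * C).IsSymm := by
    rw [IsSymm, transpose_mul]
    calc Cᵀ * Eᵀ = E * (D * Cᵀ) * Eᵀ := by rw [← mul_assoc, hED, one_mul]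
      _ = E * C := by rw [← hCD, mul_assoc, mul_assoc, hEt', mul_one]
  obtain ⟨S, T, hST, hTS, hS, hTt, hSD, hX₁, hY₂⟩ : ∃ S T : Matrix l l F, S * T = 1 ∧ T * S = 1 ∧
      S.IsSymm ∧ T.IsSymm ∧ S * D = Dᵀ * S ∧ B * E - S ≠ 0 ∧
      E * C - E * ((1 - E) * T) ≠ 0 := by
    obtain ⟨S, hS, hdet, hSD⟩ := exists_isSymm_mul_eq_transpose_mul D
    have hST := mul_nonsing_inv S hdet
    have hTS := nonsing_inv_mul S hdet
    have hS0 : S ≠ 0 := by rintro rfl; simp at hST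
    have hV : E * ((1 - E) * S⁻¹) ≠ 0 := hE0 fun h0 =>
      hE1 (((IsUnit.of_mul_eq_one _ hTS).mul_left_eq_zero).1 h0)
    have hfin {V : Matrix l l F} (hV : V ≠ 0) (M : Matrix l l F) : {c : F | M = c • V}.Finite :=
      Set.Subsingleton.finite fun a ha b hb =>
        smul_left_injective F hV (ha.symm.trans hb)
    have hfin' := (hfin hV (E * C)).preimage (inv_injective (G := F)).injOn
    obtain ⟨c, hc⟩ :=
      (((hfin hS0 (B * E)).union hfin').union (Set.finite_singleton 0)).exists_notMem
    simp only [Set.mem_union, not_or, Set.mem_ofPred_eq, Set.mem_preimage,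
      Set.mem_singleton_iff] at hc
    obtain ⟨⟨h1, h2⟩, hc0⟩ := hc
    refine ⟨c • S, c⁻¹ • S⁻¹, ?_, ?_, ?_, ?_, ?_, ?_, ?_⟩
    · rw [smul_mul_smul_comm, mul_inv_cancel₀ hc0, hST, one_smul]
    · rw [smul_mul_smul_comm, inv_mul_cancel₀ hc0, hTS, one_smul]
    · exact hS.smul c
    · exact IsSymm.smul (by rw [IsSymm, transpose_nonsing_inv, hS.eq]) _
    · rw [smul_mul_assoc, mul_smul_comm, hSD]
    · rwa [Ne, sub_eq_zero]
    · rwa [Ne, sub_eq_zero, mul_smul_comm, mul_smul_comm]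
  have hTD : T * Dᵀ = D * T := by
    calc T * Dᵀ = T * (Dᵀ * S) * T := by rw [mul_assoc, mul_assoc, hST, mul_one]
      _ = D * T := by rw [← hSD, ← mul_assoc, hTS, one_mul]
  have hET : E * T = T * Eᵀ := by
    calc E * T = E * (T * Dᵀ) * Eᵀ := by rw [mul_assoc, mul_assoc, hEt', mul_one]
      _ = T * Eᵀ := by rw [hTD, ← mul_assoc, hED, one_mul]
  have hETs : (E * T).IsSymm := by rw [IsSymm, transpose_mul, hTt.eq, hET]
  have hA : A = S * E * T + B * E * C := by
    calc A = A * (Dᵀ * Eᵀ) := by rw [hEt', mul_one]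
      _ = (1 + B * Cᵀ) * Eᵀ := by rw [← mul_assoc]; congr 1; exact sub_eq_iff_eq_add.1 hAD
      _ = Eᵀ + B * (E * C)ᵀ := by rw [add_mul, one_mul, transpose_mul, mul_assoc]
      _ = _ := by rw [hEC.eq, mul_assoc S, hET, ← mul_assoc S, hST, one_mul, mul_assoc]
  refine ⟨B * E - S, (1 - E) * T, S * D, E * C - E * ((1 - E) * T), ⟨hBE.sub hS, hX₁⟩, ⟨?_, ?_⟩,
    ⟨?_, ?_⟩, ⟨?_, hY₂⟩, ?_⟩
  · rw [sub_mul, one_mul]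
    exact hTt.sub hETs
  · intro h0
    exact hE1 (((IsUnit.of_mul_eq_one _ hTS).mul_left_eq_zero).1 h0)
  · rw [IsSymm, transpose_mul, hS.eq, hSD]
  · intro h0
    have : (1 : Matrix l l F) = 0 := by
      rw [← hDE, ← one_mul D, ← hTS, mul_assoc T, h0, mul_zero, zero_mul]
    exact one_ne_zero this
  · rw [sub_mul, one_mul, mul_sub]
    refine hEC.sub (hETs.sub ?_)
    rw [IsSymm, transpose_mul, hETs.eq, hET, ← mul_assoc, hET, mul_assoc]
  · have h22 : (1 - E) * T * (S * D) + 1 = D := by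
      rw [mul_assoc, ← mul_assoc T, hTS, one_mul, sub_mul, hED, one_mul, sub_add_cancel]
    have h21 : (1 - E) * T + D * (E * C - E * ((1 - E) * T)) = C := by
      rw [mul_sub, ← mul_assoc, ← mul_assoc, hDE, one_mul, one_mul, add_sub_cancel]
    have h12 : S * D + (B * E - S) * D = B := by
      rw [← add_mul, add_sub_cancel, mul_assoc, hED, mul_one]
    have h11 (X₁ Y₁ X₂ Y₂ : Matrix l l F) : (1 + X₁ * Y₁) * (1 + X₂ * Y₂) + X₁ * Y₂ =
        1 + X₂ * Y₂ + X₁ * (Y₁ + (Y₁ * X₂ + 1) * Y₂) := by noncomm_ring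
    have h12' (X₁ Y₁ X₂ : Matrix l l F) : (1 + X₁ * Y₁) * X₂ + X₁ * 1 =
        X₂ + X₁ * (Y₁ * X₂ + 1) := by noncomm_ring
    have h21' (Y₁ X₂ Y₂ : Matrix l l F) : Y₁ * (1 + X₂ * Y₂) + 1 * Y₂ =
        Y₁ + (Y₁ * X₂ + 1) * Y₂ := by noncomm_ring
    have hXY : S * D * (E * C - E * ((1 - E) * T)) = S * C - 1 + S * E * T := by
      rw [mul_sub, mul_assoc, mul_assoc, ← mul_assoc D, ← mul_assoc D, hDE, one_mul, one_mul,
        sub_mul, mul_sub, one_mul, hST, mul_assoc]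
      abel
    rw [fromBlocks_multiply, h11, h12', h21', h22, h21, h12, hXY, hA]
    congr 1
    · rw [sub_mul]
      abel
    · rw [mul_one, h22]

end SymplecticGroup

namespace SymplecticGroup

theorem mem_isRegularUnipotent_pow_four {F : Type*} [Field F] [Infinite F] (h2 : (2 : F) ≠ 0)
    {m : ℕ} {u : symplecticGroup (Fin (m + 1)) F} (hu : IsRegularUnipotent u.1)
    (g : symplecticGroup (Fin (m + 1)) F) :
    g ∈ {w : symplecticGroup (Fin (m + 1)) F | IsRegularUnipotent w.1} ^ 4 := by
  by_cases hg : g = 1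
  · rw [hg, show (1 : symplecticGroup (Fin (m + 1)) F) = u * u⁻¹ * u * u⁻¹ by group, pow_succ,
      pow_succ, pow_two]
    exact Set.mul_mem_mul (Set.mul_mem_mul (Set.mul_mem_mul hu hu.inv) hu) hu.inv
  obtain ⟨t, hdet, h1⟩ := exists_conj_isUnit_det_toBlocks₂₂ hg
  obtain ⟨X₁, Y₁, X₂, Y₂, ⟨hX₁, hX₁0⟩, ⟨hY₁, hY₁0⟩, ⟨hX₂, hX₂0⟩, ⟨hY₂, hY₂0⟩, h⟩ :=
    exists_isSymm_eq_mul ((fromBlocks_toBlocks (t * g * t⁻¹).1).symm ▸ (t * g * t⁻¹).2) hdet h1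
  rw [fromBlocks_toBlocks] at h
  obtain ⟨g₁, hg₁⟩ := exists_coe_eq_fromBlocks_mul hX₁ hY₁
  obtain ⟨g₂, hg₂⟩ := exists_coe_eq_fromBlocks_mul hX₂ hY₂
  have h₁ := mem_isRegularUnipotent_mul h2 hX₁ hX₁0 hY₁ hY₁0 hg₁
  have h₂ := mem_isRegularUnipotent_mul h2 hX₂ hX₂0 hY₂ hY₂0 hg₂
  have hmul : t * g * t⁻¹ = g₁ * g₂ := Subtype.ext (by rw [h, ← hg₁, ← hg₂]; rfl)
  obtain ⟨a, ha, b, hb, hab⟩ := Set.mem_mul.1 h₁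
  obtain ⟨c, hc, d, hd, hcd⟩ := Set.mem_mul.1 h₂
  have hgeq : g = t⁻¹ * a * t⁻¹⁻¹ * (t⁻¹ * b * t⁻¹⁻¹) * (t⁻¹ * c * t⁻¹⁻¹) *
      (t⁻¹ * d * t⁻¹⁻¹) := by
    calc g = t⁻¹ * (t * g * t⁻¹) * t := by group
      _ = _ := by rw [hmul, ← hab, ← hcd]; group
  rw [hgeq, pow_succ, pow_succ, pow_two]
  exact Set.mul_mem_mul (Set.mul_mem_mul (Set.mul_mem_mul (IsRegularUnipotent.conj ha _)
    (IsRegularUnipotent.conj hb _)) (IsRegularUnipotent.conj hc _)) (IsRegularUnipotent.conj hd _)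

end SymplecticGroup

/-- The conjugacy class of a regular unipotent element of the symplectic group
`Sp_{2n}(F)` (char F ≠ 2) covers the group in four steps. The hypothesis `hSp`
records that `Matrix.symplecticGroup (Fin n) F` is exactly the set of matrices
`M` with `M·J·Mᵀ = J` for the standard form `J = [[0, 1], [-1, 0]]`. -/
theorem regular_unipotent_class_pow_four_symplectic {F : Type*} [Field F]
    [IsAlgClosed F] (hF : ringChar F ≠ 2) (n : ℕ) (hn : 1 ≤ n)
    (J : Matrix (Fin n ⊕ Fin n) (Fin n ⊕ Fin n) F)
    (hJ : J = Matrix.fromBlocks 0 1 (-1) 0)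
    (hSp : ∀ M : Matrix (Fin n ⊕ Fin n) (Fin n ⊕ Fin n) F,
      M ∈ Matrix.symplecticGroup (Fin n) F ↔ M * J * Mᵀ = J)
    (u : Matrix.symplecticGroup (Fin n) F)
    (hu : ((u : Matrix (Fin n ⊕ Fin n) (Fin n ⊕ Fin n) F) - 1) ^ (2 * n) = 0)
    (hu' : ((u : Matrix (Fin n ⊕ Fin n) (Fin n ⊕ Fin n) F) - 1) ^ (2 * n - 1) ≠ 0)
    (C : Set (Matrix.symplecticGroup (Fin n) F))
    (hC : C = {g | ∃ h : Matrix.symplecticGroup (Fin n) F, g = h * u * h⁻¹}) :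
    C ^ 4 = Set.univ := by
  have h2 : (2 : F) ≠ 0 := Ring.two_ne_zero hF
  obtain ⟨m, rfl⟩ : ∃ m, n = m + 1 := ⟨n - 1, by omega⟩
  refine Set.eq_univ_of_forall fun g => Set.pow_subset_pow_left (fun w hw => ?_)
    (SymplecticGroup.mem_isRegularUnipotent_pow_four h2 (u := u) ⟨hu, hu'⟩ g)
  obtain ⟨P, hP, h⟩ := IsRegularUnipotent.exists_similar ⟨hu, hu'⟩ hw
  rw [hC]
  exact SymplecticGroup.exists_conj_of_similar h2 u w P hP h
end

section
/- Let F be an algebraically closed field of characteristic different from 2, let n ≥ 1, and let Sp_{2n}(F) be the symplectic group of 2n×2n matrices M over F satisfying M·J·Mᵀ = J, where J is the standard symplectic form matrix [[0, I_n], [−I_n, 0]]. Let N be a normal subset of Sp_{2n}(F) (i.e., hgh⁻¹ ∈ N for all g ∈ N and h ∈ Sp_{2n}(F)) that contains a matrix s whose characteristic polynomial has 2n distinct roots in F. Then N·N·N = Sp_{2n}(F). -/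
open Pointwise Matrix

section Flag

variable {F V : Type*} [Field F] [AddCommGroup V] [Module F V] [FiniteDimensional F V]

/-- Over an algebraically closed field, an endomorphism preserving nested subspaces `W < P` has an
eigenvector modulo `W` in `P`. -/
theorem exists_eigenvector_mod_of_lt [IsAlgClosed F] (f : V →ₗ[F] V) {W P : Submodule F V}
    (hWP : W < P) (hW : ∀ x ∈ W, f x ∈ W) (hP : ∀ x ∈ P, f x ∈ P) :
    ∃ v ∈ P, v ∉ W ∧ ∃ c : F, f v - c • v ∈ W := by
  have hQ : ∀ q ∈ P.map W.mkQ, W.mapQ W f hW q ∈ P.map W.mkQ := by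
    rintro _ ⟨x, hx, rfl⟩
    exact ⟨f x, hP x hx, by simp⟩
  obtain ⟨x, hxP, hxW⟩ := SetLike.exists_of_lt hWP
  have : Nontrivial (P.map W.mkQ) := by
    refine ⟨⟨⟨W.mkQ x, x, hxP, rfl⟩, 0, fun h => hxW ?_⟩⟩
    simpa using congrArg Subtype.val h
  obtain ⟨c, hc⟩ := Module.End.exists_eigenvalue ((W.mapQ W f hW).restrict hQ)
  obtain ⟨⟨_, v, hv, rfl⟩, hq⟩ := hc.exists_hasEigenvector
  refine ⟨v, hv, fun h => hq.2 (Subtype.ext (by simpa using h)), c, ?_⟩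
  rw [← Submodule.Quotient.mk_eq_zero, Submodule.Quotient.mk_sub, sub_eq_zero]
  simpa using congrArg Subtype.val hq.apply_eq_smul

/-- An isometry of an alternating form over an algebraically closed field stabilises a flag of
isotropic subspaces of every dimension up to half the dimension of the space. -/
theorem exists_isotropic_flag [IsAlgClosed F] (B : V →ₗ[F] V →ₗ[F] F) (hB : B.IsAlt)
    (f : V →ₗ[F] V) (hinj : Function.Injective f) (hf : ∀ x y, B (f x) (f y) = B x y) :
    ∀ k : ℕ, 2 * k ≤ Module.finrank F V → ∃ e : Fin k → V, LinearIndependent F e ∧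
      (∀ i j, B (e i) (e j) = 0) ∧ ∀ i, f (e i) ∈ Submodule.span F (e '' Set.Iic i) := by
  intro k
  induction k with
  | zero => exact fun _ => ⟨Fin.elim0, linearIndependent_empty_type, fun i => i.elim0,
      fun i => i.elim0⟩
  | succ k ih =>
    intro hk
    obtain ⟨e, he, hiso, hflag⟩ := ih (by omega)
    set W := Submodule.span F (Set.range e) with hWdef
    let φ : V →ₗ[F] Fin k → F := LinearMap.pi fun i => B (e i)
    have hφ (v) : v ∈ φ.ker ↔ ∀ w ∈ W, B w v = 0 := by
      constructor
      · intro h w hw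
        have : W ≤ (B.flip v).ker := Submodule.span_le.2 (by
          rintro _ ⟨i, rfl⟩
          exact congrFun (LinearMap.mem_ker.1 h) i)
        exact this hw
      · exact fun h => LinearMap.mem_ker.2 (funext fun i => h _ (Submodule.subset_span ⟨i, rfl⟩))
    have hW : ∀ x ∈ W, f x ∈ W := by
      have : W ≤ W.comap f := Submodule.span_le.2 (by
        rintro _ ⟨i, rfl⟩
        exact Submodule.span_mono (Set.image_subset_range _ _) (hflag i))
      exact this
    have hsurj : Function.Surjective (f.restrict hW) :=
      LinearMap.injective_iff_surjective.1 fun x y h =>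
        Subtype.ext (hinj (by simpa using congrArg Subtype.val h))
    have hP : ∀ x ∈ φ.ker, f x ∈ φ.ker := by
      intro x hx
      rw [hφ] at hx ⊢
      intro w hw
      obtain ⟨u, hu⟩ := hsurj ⟨w, hw⟩
      have hu' : f u = w := congrArg Subtype.val hu
      rw [← hu', hf]
      exact hx _ u.2
    have hWP : W < φ.ker := by
      refine lt_of_le_of_ne (Submodule.span_le.2 ?_) fun h => ?_
      · rintro _ ⟨i, rfl⟩
        exact LinearMap.mem_ker.2 (funext fun j => hiso j i)
      · have h1 := φ.finrank_range_add_finrank_ker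
        have h2 : Module.finrank F φ.range ≤ k := by simpa using Submodule.finrank_le φ.range
        have h3 := finrank_span_eq_card he
        rw [← hWdef, h, Fintype.card_fin] at h3
        omega
    obtain ⟨v, hvP, hvW, c, hc⟩ := exists_eigenvector_mod_of_lt f hWP hW hP
    have hve (i) : B (e i) v = 0 := congrFun (LinearMap.mem_ker.1 hvP) i
    refine ⟨Fin.snoc e v, linearIndependent_finSnoc.2 ⟨he, hvW⟩, ?_, ?_⟩
    · intro i j
      refine Fin.lastCases ?_ (fun i => ?_) i <;> refine Fin.lastCases ?_ (fun j => ?_) j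
      · simpa using hB v
      · simpa [hve j] using (hB.neg (e j) v).symm
      · simpa using hve i
      · simpa using hiso i j
    · intro i
      refine Fin.lastCases ?_ (fun i => ?_) i
      · rw [Fin.snoc_last, ← sub_add_cancel (f v) (c • v)]
        refine add_mem (Submodule.span_mono ?_ hc)
          (Submodule.smul_mem _ _ (Submodule.subset_span ⟨Fin.last k, by simp⟩))
        rintro _ ⟨j, rfl⟩
        exact ⟨j.castSucc, by simp [Fin.le_last], by simp⟩
      · rw [Fin.snoc_castSucc]
        refine Submodule.span_mono ?_ (hflag i)
        rintro _ ⟨j, hj, rfl⟩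
        exact ⟨j.castSucc, by simpa using hj, by simp⟩

end Flag

namespace SymplecticGroup

variable {l F : Type*} [Fintype l] [DecidableEq l] [Field F]

/-- The columns of `E` span a Lagrangian subspace; they can be completed to a symplectic basis. -/
theorem exists_fromCols_mem (h2 : (2 : F) ≠ 0) (E : Matrix (l ⊕ l) l F)
    (hE : LinearIndependent F E.col) (hiso : Eᵀ * J l F * E = 0) :
    ∃ X : Matrix (l ⊕ l) l F, fromCols E X ∈ symplecticGroup l F := by
  obtain ⟨L, hL⟩ : ∃ L : Matrix l (l ⊕ l) F, L * E = 1 := by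
    obtain ⟨g, hg⟩ := (toLin' E).exists_leftInverse_of_injective
      (LinearMap.ker_eq_bot.2 (mulVec_injective_iff.2 hE))
    exact ⟨LinearMap.toMatrix' g, by
      rw [← LinearMap.toMatrix'_toLin' E, ← LinearMap.toMatrix'_comp, hg, LinearMap.toMatrix'_id]⟩
  obtain ⟨Y, hY⟩ : ∃ Y, Y = J l F * Lᵀ := ⟨_, rfl⟩
  have hEY : Eᵀ * J l F * Y = -1 := by
    rw [hY, Matrix.mul_assoc, ← Matrix.mul_assoc (J l F), J_squared, Matrix.neg_mul,
      Matrix.one_mul, Matrix.mul_neg, ← transpose_mul, hL, transpose_one]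
  have hYE : Yᵀ * J l F * E = 1 := by
    have := congrArg transpose hEY
    simpa [Matrix.mul_assoc] using this
  set K := Yᵀ * J l F * Y with hK
  have hKt : Kᵀ = -K := by simp [hK, Matrix.mul_assoc]
  refine ⟨Y - E * ((2 : F)⁻¹ • K), ?_⟩
  have hEX : Eᵀ * J l F * (Y - E * ((2 : F)⁻¹ • K)) = -1 := by
    rw [Matrix.mul_sub, ← Matrix.mul_assoc, hiso, hEY]; simp
  have hXE : (Y - E * ((2 : F)⁻¹ • K))ᵀ * J l F * E = 1 := by
    have := congrArg transpose hEX
    simpa [Matrix.mul_assoc] using this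
  have hXX : (Y - E * ((2 : F)⁻¹ • K))ᵀ * J l F * (Y - E * ((2 : F)⁻¹ • K)) = 0 := by
    rw [Matrix.mul_sub, ← Matrix.mul_assoc _ E, hXE, transpose_sub, transpose_mul, Matrix.sub_mul,
      Matrix.sub_mul, Matrix.mul_assoc _ Eᵀ, Matrix.mul_assoc _ (Eᵀ * _), hEY, ← hK,
      transpose_smul, hKt, Matrix.one_mul, Matrix.mul_neg, Matrix.mul_one, smul_neg, neg_neg,
      sub_sub, ← add_smul, ← two_mul, mul_inv_cancel₀ h2, one_smul, sub_self]
  rw [mem_iff', transpose_fromCols, fromRows_mul, fromRows_mul_fromCols, hiso, hEX, hXE, hXX, J]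

/-- Every symplectic matrix over an algebraically closed field is conjugate into the standard Borel
subgroup. -/
theorem exists_conj_upperTriangular [IsAlgClosed F] (h2 : (2 : F) ≠ 0) {n : ℕ}
    (M : symplecticGroup (Fin n) F) :
    ∃ (h : symplecticGroup (Fin n) F) (A B D : Matrix (Fin n) (Fin n) F), A.IsUpperTriangular ∧
      (↑(h⁻¹ * M * h) : Matrix (Fin n ⊕ Fin n) (Fin n ⊕ Fin n) F) = fromBlocks A B 0 D := by
  obtain ⟨e, he, hiso, hflag⟩ := exists_isotropic_flag
    (toLinearMap₂' F (J (Fin n) F)) (fun x => by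
      rw [toLinearMap₂'_apply', ← Sum.elim_comp_inl_inr x, J, fromBlocks_mulVec,
        sumElim_dotProduct_sumElim]
      simp [neg_mulVec, dotProduct_comm (x ∘ Sum.inr)])
    (toLin' (M : Matrix (Fin n ⊕ Fin n) (Fin n ⊕ Fin n) F))
    (mulVec_injective_iff_isUnit.2 ((isUnit_iff_isUnit_det _).2 (symplectic_det M.2)))
    (fun x y => by
      rw [toLinearMap₂'_apply', toLinearMap₂'_apply', toLin'_apply, toLin'_apply,
        dotProduct_mulVec, vecMul_mulVec, ← dotProduct_mulVec, mulVec_mulVec, mem_iff'.1 M.2])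
    n (by simp [two_mul])
  set E : Matrix (Fin n ⊕ Fin n) (Fin n) F := of fun a i => e i a with hEdef
  have hEcol : E.col = e := rfl
  choose c hc hce using fun i => (Finsupp.mem_span_image_iff_linearCombination F).1 (hflag i)
  set A : Matrix (Fin n) (Fin n) F := of fun j i => c i j with hA
  have hME : (M : Matrix (Fin n ⊕ Fin n) (Fin n ⊕ Fin n) F) * E = E * A := by
    ext a i
    have := congrFun (hce i) a
    rw [Finsupp.linearCombination_apply, Finsupp.sum_fintype _ _ (by simp), toLin'_apply] at this
    simp only [Finset.sum_apply, Pi.smul_apply, smul_eq_mul] at this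
    simp only [mul_apply, hEdef, hA, of_apply, mul_comm (e _ _)]
    exact this.symm
  have hEiso : Eᵀ * J (Fin n) F * E = 0 := by
    ext i j
    have := hiso i j
    rw [toLinearMap₂'_apply', dotProduct_mulVec] at this
    exact this
  obtain ⟨X, hX⟩ := exists_fromCols_mem h2 E (hEcol ▸ he) hEiso
  let h : symplecticGroup (Fin n) F := ⟨_, hX⟩
  have hE1 : (↑h⁻¹ : Matrix (Fin n ⊕ Fin n) (Fin n ⊕ Fin n) F) * E = fromRows 1 0 := by
    have h1 : (↑h⁻¹ : Matrix (Fin n ⊕ Fin n) (Fin n ⊕ Fin n) F) * fromCols E X = 1 :=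
      congrArg Subtype.val (inv_mul_cancel h)
    rw [mul_fromCols, ← fromBlocks_one, ← fromCols_fromRows_eq_fromBlocks] at h1
    exact (fromCols_inj h1).1
  obtain ⟨R, hR⟩ : ∃ R, R = (↑(h⁻¹ * M) : Matrix (Fin n ⊕ Fin n) (Fin n ⊕ Fin n) F) * X :=
    ⟨_, rfl⟩
  have hT : (↑(h⁻¹ * M * h) : Matrix (Fin n ⊕ Fin n) (Fin n ⊕ Fin n) F) =
      fromCols (fromRows A 0) R := by
    change (↑(h⁻¹ * M) : Matrix (Fin n ⊕ Fin n) (Fin n ⊕ Fin n) F) * fromCols E X = _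
    rw [mul_fromCols, ← hR, Submonoid.coe_mul, Matrix.mul_assoc _ _ E, hME, ← Matrix.mul_assoc,
      hE1, fromRows_mul, Matrix.one_mul, Matrix.zero_mul]
  refine ⟨h, A, R.toRows₁, R.toRows₂, ?_, ?_⟩
  · intro j i hij
    by_contra hne
    exact absurd (hc i (Finsupp.mem_support_iff.2 hne)) (not_le.2 hij)
  · rw [hT, ← fromCols_fromRows_eq_fromBlocks, fromRows_toRows]

theorem charpoly_conj (g h : symplecticGroup l F) :
    (↑(h * g * h⁻¹) : Matrix (l ⊕ l) (l ⊕ l) F).charpoly =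
      (g : Matrix (l ⊕ l) (l ⊕ l) F).charpoly := by
  let u : (Matrix (l ⊕ l) (l ⊕ l) F)ˣ := ⟨h, ↑h⁻¹, congrArg Subtype.val (mul_inv_cancel h),
    congrArg Subtype.val (inv_mul_cancel h)⟩
  have := charpoly_units_conj u (g : Matrix (l ⊕ l) (l ⊕ l) F)
  rwa [← coe_units_inv] at this

theorem charpoly_inv (g : symplecticGroup l F) :
    (↑g⁻¹ : Matrix (l ⊕ l) (l ⊕ l) F).charpoly = (g : Matrix (l ⊕ l) (l ⊕ l) F).charpoly := by
  have h := charpoly_conj ⟨_, transpose_mem g.2⟩ (symJ l F)⁻¹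
  rw [charpoly_transpose] at h
  rw [← h]
  congr 1
  simp [coe_inv, J_squared]

/-- The characteristic polynomial of an element of the standard Borel subgroup. -/
theorem charpoly_of_upperTriangular [LinearOrder l] {A B D : Matrix l l F}
    (hA : A.IsUpperTriangular) (h : fromBlocks A B 0 D ∈ symplecticGroup l F) :
    (∀ i, A i i ≠ 0) ∧ (fromBlocks A B 0 D).charpoly =
      ∏ k, (Polynomial.X - Polynomial.C (Sum.elim (fun i => A i i) (fun i => (A i i)⁻¹) k)) := by
  have hDA : Dᵀ * A = 1 := by
    have := (fromBlocks_mem_iff.1 h).2.2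
    simpa using congrArg transpose this
  have : Invertible A := invertibleOfLeftInverse _ _ hDA
  have hD : Dᵀ.IsUpperTriangular := by
    rw [← inv_eq_left_inv hDA]
    exact blockTriangular_inv_of_blockTriangular hA
  have hdiag (i) : Dᵀ i i * A i i = 1 := by
    have := congrFun (congrFun hDA i) i
    rw [mul_apply, one_apply_eq, Finset.sum_eq_single i] at this
    · exact this
    · intro j _ hj
      rcases lt_or_gt_of_ne hj with hj | hj
      · rw [hD hj, zero_mul]
      · rw [hA hj, mul_zero]
    · simp
  refine ⟨fun i hi => by simpa [hi] using hdiag i, ?_⟩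
  rw [charpoly_fromBlocks_zero₂₁, ← charpoly_transpose D, charpoly_of_isUpperTriangular A hA,
    charpoly_of_isUpperTriangular _ hD, Fintype.prod_sum_type]
  simp only [Sum.elim_inl, Sum.elim_inr, fun i => eq_inv_of_mul_eq_one_left (hdiag i)]

/-- A matrix having all entries of an injective family as eigenvalues is diagonalisable. -/
theorem exists_isUnit_mul_eq_mul_diagonal {m : Type*} [Fintype m] [DecidableEq m]
    (M : Matrix m m F) (δ : m → F) (hδ : Function.Injective δ) (hM : ∀ k, M.charpoly.IsRoot (δ k)) :
    ∃ H : Matrix m m F, IsUnit H ∧ M * H = H * diagonal δ := by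
  have hv (k) : ∃ v, Module.End.HasEigenvector (toLin' M) (δ k) v :=
    ((Module.End.hasEigenvalue_iff_isRoot_charpoly _ _).2
      (by rw [charpoly_toLin']; exact hM k)).exists_hasEigenvector
  choose v hv using hv
  refine ⟨of fun a k => v k a, linearIndependent_cols_iff_isUnit.1
    (Module.End.eigenvectors_linearIndependent' _ δ hδ v hv), ?_⟩
  ext a k
  have := congrFun (hv k).apply_eq_smul a
  rw [toLin'_apply] at this
  rw [mul_diagonal, mul_comm]
  exact this

/-- If a diagonal matrix with distinct diagonal entries `d i, (d i)⁻¹` preserves the form with Gram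
matrix `K`, then `K` pairs the eigenvector of each eigenvalue only with that of its inverse. -/
theorem eq_zero_of_diagonal_mul_mul_diagonal (d : l → F)
    (hd : Function.Injective (Sum.elim d fun i => (d i)⁻¹)) {K : Matrix (l ⊕ l) (l ⊕ l) F}
    (hK : diagonal (Sum.elim d fun i => (d i)⁻¹) * K * diagonal (Sum.elim d fun i => (d i)⁻¹) = K)
    (a b : l ⊕ l) (hab : a ≠ b.swap) : K a b = 0 := by
  have h1 := congrFun (congrFun hK a) b
  rw [mul_diagonal, diagonal_mul] at h1
  by_contra h0
  have h2 : Sum.elim d (fun i => (d i)⁻¹) a * Sum.elim d (fun i => (d i)⁻¹) b = 1 :=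
    mul_right_cancel₀ h0 (by linear_combination h1)
  refine hab (hd ?_)
  rw [eq_inv_of_mul_eq_one_left h2]
  cases b <;> simp

/-- A symplectic matrix with distinct eigenvalues `d i, (d i)⁻¹` is conjugate, within the symplectic
group, to the diagonal matrix of its eigenvalues. -/
theorem exists_mul_eq_mul_diagonal (M : symplecticGroup l F) (d : l → F)
    (hd : Function.Injective (Sum.elim d fun i => (d i)⁻¹))
    (hM : ∀ k, (M : Matrix (l ⊕ l) (l ⊕ l) F).charpoly.IsRoot (Sum.elim d (fun i => (d i)⁻¹) k)) :
    ∃ H : symplecticGroup l F, (M : Matrix (l ⊕ l) (l ⊕ l) F) * H =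
      H * diagonal (Sum.elim d fun i => (d i)⁻¹) := by
  obtain ⟨H, hHu, hMH⟩ := exists_isUnit_mul_eq_mul_diagonal (M : Matrix (l ⊕ l) (l ⊕ l) F) _ hd hM
  obtain ⟨K, hK⟩ : ∃ K, K = Hᵀ * J l F * H := ⟨_, rfl⟩
  have hKδ (δ : l ⊕ l → F) (hMH : (M : Matrix (l ⊕ l) (l ⊕ l) F) * H = H * diagonal δ) :
      diagonal δ * K * diagonal δ = K := by
    calc diagonal δ * K * diagonal δ
        = (H * diagonal δ)ᵀ * J l F * (H * diagonal δ) := by simp [hK, Matrix.mul_assoc]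
      _ = Hᵀ * ((M : Matrix (l ⊕ l) (l ⊕ l) F)ᵀ * J l F * M) * H := by
        rw [← hMH]; simp [Matrix.mul_assoc]
      _ = K := by rw [mem_iff'.1 M.2, hK]
  have hK0 := eq_zero_of_diagonal_mul_mul_diagonal d hd (hKδ _ hMH)
  have hKt : Kᵀ = -K := by simp [hK, Matrix.mul_assoc]
  have h12 (i) : K (.inl i) (.inr i) = - K (.inr i) (.inl i) :=
    congrFun (congrFun hKt (.inr i)) (.inl i)
  have hκ (i) : K (.inr i) (.inl i) ≠ 0 := by
    intro h0
    have hdet : K.det = 0 := det_eq_zero_of_column_eq_zero (.inl i) fun a => by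
      by_cases ha : a = .inr i
      · rw [ha, h0]
      · exact hK0 a (.inl i) ha
    have hHd := ((isUnit_iff_isUnit_det _).1 hHu).ne_zero
    have hJ := (isUnit_det_J l F).ne_zero
    rw [hK, det_mul, det_mul, det_transpose] at hdet
    exact mul_ne_zero (mul_ne_zero hHd hJ) hHd hdet
  obtain ⟨c, hc⟩ : ∃ c : l ⊕ l → F,
    c = Sum.elim (fun _ => 1) fun i => (K (.inr i) (.inl i))⁻¹ := ⟨_, rfl⟩
  refine ⟨⟨H * diagonal c, mem_iff'.2 ?_⟩, ?_⟩
  · have : (H * diagonal c)ᵀ * J l F * (H * diagonal c) = diagonal c * K * diagonal c := by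
      simp [hK, Matrix.mul_assoc]
    rw [this]
    ext a b
    rw [mul_diagonal, diagonal_mul]
    by_cases hab : a = b.swap
    · subst hab
      rcases b with i | i
      · simp [hc, J, hκ]
      · simp [hc, J, hκ, h12]
    · rw [hK0 a b hab]
      rcases a with i | i <;> rcases b with j | j <;> simp_all [J, one_apply]
  · change (M : Matrix (l ⊕ l) (l ⊕ l) F) * (H * diagonal c) = H * diagonal c * diagonal _
    rw [← Matrix.mul_assoc, hMH, Matrix.mul_assoc, Matrix.mul_assoc, diagonal_mul_diagonal,
      diagonal_mul_diagonal]
    simp only [mul_comm]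

/-- Two symplectic matrices with the same characteristic polynomial, having distinct roots
`d i, (d i)⁻¹`, are conjugate within the symplectic group. -/
theorem exists_conj_of_charpoly_eq (M M' : symplecticGroup l F) (d : l → F)
    (hd : Function.Injective (Sum.elim d fun i => (d i)⁻¹))
    (hM : (M : Matrix (l ⊕ l) (l ⊕ l) F).charpoly =
      ∏ k, (Polynomial.X - Polynomial.C (Sum.elim d (fun i => (d i)⁻¹) k)))
    (hM' : (M' : Matrix (l ⊕ l) (l ⊕ l) F).charpoly =
      (M : Matrix (l ⊕ l) (l ⊕ l) F).charpoly) :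
    ∃ h : symplecticGroup l F, h * M * h⁻¹ = M' := by
  have hroot (k) : (M : Matrix (l ⊕ l) (l ⊕ l) F).charpoly.IsRoot
      (Sum.elim d (fun i => (d i)⁻¹) k) := by
    rw [hM, Polynomial.IsRoot, Polynomial.eval_prod]
    exact Finset.prod_eq_zero (Finset.mem_univ k) (by simp)
  obtain ⟨H, hH⟩ := exists_mul_eq_mul_diagonal M d hd hroot
  obtain ⟨H', hH'⟩ := exists_mul_eq_mul_diagonal M' d hd (hM' ▸ hroot)
  have hinv (X : symplecticGroup l F) : (↑X⁻¹ : Matrix (l ⊕ l) (l ⊕ l) F) * X = 1 :=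
    congrArg Subtype.val (inv_mul_cancel X)
  have key : H⁻¹ * M * H = H'⁻¹ * M' * H' := by
    apply Subtype.ext
    simp only [Submonoid.coe_mul]
    rw [Matrix.mul_assoc, hH, Matrix.mul_assoc, hH', ← Matrix.mul_assoc, ← Matrix.mul_assoc, hinv,
      hinv]
  refine ⟨H' * H⁻¹, ?_⟩
  calc H' * H⁻¹ * M * (H' * H⁻¹)⁻¹ = H' * (H⁻¹ * M * H) * H'⁻¹ := by group
    _ = M' := by rw [key]; group

/-- Every element of the standard Borel subgroup is a product of three symplectic matrices with
eigenvalues `d i, (d i)⁻¹`. -/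
theorem exists_mul_mul_of_upperTriangular [LinearOrder l] (g : symplecticGroup l F)
    {A B D : Matrix l l F} (hA : A.IsUpperTriangular)
    (hg : (g : Matrix (l ⊕ l) (l ⊕ l) F) = fromBlocks A B 0 D) (d : l → F) (hd : ∀ i, d i ≠ 0) :
    ∃ x y z : symplecticGroup l F, x * y * z = g ∧ ∀ w ∈ ({x, y, z} : Set (symplecticGroup l F)),
      (w : Matrix (l ⊕ l) (l ⊕ l) F).charpoly =
        ∏ k, (Polynomial.X - Polynomial.C (Sum.elim d (fun i => (d i)⁻¹) k)) := by
  obtain ⟨hA0, -⟩ := charpoly_of_upperTriangular hA (hg ▸ g.2)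
  let a : symplecticGroup l F := ⟨fromBlocks (diagonal d) 0 (diagonal d⁻¹) (diagonal d⁻¹), by
    simp [fromBlocks_mem_iff, hd]⟩
  let u : symplecticGroup l F := ⟨fromBlocks 1 (diagonal fun i => d i / A i i - d i ^ 2) 0 1, by
    simp [fromBlocks_mem_iff]⟩
  let b : symplecticGroup l F :=
    ⟨fromBlocks (diagonal d⁻¹) 0 (-diagonal fun i => A i i) (diagonal d), by
      simp [fromBlocks_mem_iff, hd, mul_comm]⟩
  let t := b * (u * (a * g) * u⁻¹)
  have hu : (↑u⁻¹ : Matrix (l ⊕ l) (l ⊕ l) F) =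
      fromBlocks 1 (-diagonal fun i => d i / A i i - d i ^ 2) 0 1 := by
    simp [coe_inv, u, J, fromBlocks_transpose, fromBlocks_multiply, fromBlocks_neg]
  obtain ⟨B', D', ht⟩ : ∃ B' D', (t : Matrix (l ⊕ l) (l ⊕ l) F) =
      fromBlocks (diagonal (fun i => (d i)⁻¹ * (A i i)⁻¹) * A) B' 0 D' := by
    refine ⟨_, _, (?_ : _ = fromBlocks _ ((t : Matrix (l ⊕ l) (l ⊕ l) F).toBlocks₁₂) _
      ((t : Matrix (l ⊕ l) (l ⊕ l) F).toBlocks₂₂))⟩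
    simp only [t, Submonoid.coe_mul, hu, hg, a, u, b, fromBlocks_multiply, toBlocks_fromBlocks₁₂,
      toBlocks_fromBlocks₂₂]
    congr 1
    · ext i j
      simp
      field_simp [hd i, hA0 i]
      ring
    · ext i j
      simp
      field_simp [hd i, hA0 i]
      ring
  refine ⟨a⁻¹, u⁻¹ * b⁻¹ * u, u⁻¹ * t * u, by simp only [t]; group, ?_⟩
  have hswap (e : l → F) : ∏ k, (Polynomial.X - Polynomial.C
      (Sum.elim (fun i => (e i)⁻¹) e k)) =
        ∏ k, (Polynomial.X - Polynomial.C (Sum.elim e (fun i => (e i)⁻¹) k)) := by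
    simp only [Fintype.prod_sum_type, Sum.elim_inl, Sum.elim_inr, mul_comm]
  have hconj (w : symplecticGroup l F) :
      (↑(u⁻¹ * w * u) : Matrix (l ⊕ l) (l ⊕ l) F).charpoly =
        (w : Matrix (l ⊕ l) (l ⊕ l) F).charpoly := by
    simpa using charpoly_conj w u⁻¹
  rintro w (rfl | rfl | rfl)
  · rw [charpoly_inv, charpoly_fromBlocks_zero₁₂, charpoly_diagonal, charpoly_diagonal,
      Fintype.prod_sum_type]
    rfl
  · rw [hconj, charpoly_inv, charpoly_fromBlocks_zero₁₂, charpoly_diagonal, charpoly_diagonal,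
      ← hswap, Fintype.prod_sum_type]
    rfl
  · have hU : (diagonal (fun i => (d i)⁻¹ * (A i i)⁻¹) * A).IsUpperTriangular :=
      (blockTriangular_diagonal _).mul hA
    rw [hconj, ht, (charpoly_of_upperTriangular hU (ht ▸ t.2)).2, ← hswap]
    simp [hA0]

end SymplecticGroup

/-- Paper's Lemma 3.2 for the symplectic group `Sp_{2n}(F)` (char F ≠ 2): a
normal subset containing a regular semisimple element (an element whose
characteristic polynomial has `2n` distinct roots in `F`) covers the group in
three steps. The hypothesis `hSp` records that `Matrix.symplecticGroup (Fin n) F`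
is exactly the set of matrices `M` with `M·J·Mᵀ = J` for the standard form
`J = [[0, 1], [-1, 0]]`. -/
theorem normal_subset_regular_semisimple_cube_symplectic {F : Type*} [Field F]
    [IsAlgClosed F] (hF : ringChar F ≠ 2) (n : ℕ) (hn : 1 ≤ n)
    (J : Matrix (Fin n ⊕ Fin n) (Fin n ⊕ Fin n) F)
    (hJ : J = Matrix.fromBlocks 0 1 (-1) 0)
    (hSp : ∀ M : Matrix (Fin n ⊕ Fin n) (Fin n ⊕ Fin n) F,
      M ∈ Matrix.symplecticGroup (Fin n) F ↔ M * J * Mᵀ = J)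
    (N : Set (Matrix.symplecticGroup (Fin n) F))
    (hN : ∀ g ∈ N, ∀ h : Matrix.symplecticGroup (Fin n) F, h * g * h⁻¹ ∈ N)
    (s : Matrix.symplecticGroup (Fin n) F) (hs : s ∈ N)
    (hreg : (s : Matrix (Fin n ⊕ Fin n) (Fin n ⊕ Fin n) F).charpoly.roots.Nodup ∧
      Multiset.card (s : Matrix (Fin n ⊕ Fin n) (Fin n ⊕ Fin n) F).charpoly.roots = 2 * n) :
    N * N * N = Set.univ := by
  have h2 : (2 : F) ≠ 0 := Ring.two_ne_zero hF
  obtain ⟨h, A, B, D, hA, hT⟩ := SymplecticGroup.exists_conj_upperTriangular h2 s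
  obtain ⟨hd0, hchar⟩ := SymplecticGroup.charpoly_of_upperTriangular hA (hT ▸ (h⁻¹ * s * h).2)
  have hconj := SymplecticGroup.charpoly_conj s h⁻¹
  rw [inv_inv, hT, hchar] at hconj
  have hd : Function.Injective (Sum.elim (fun i => A i i) fun i => (A i i)⁻¹) := by
    have hroots := Polynomial.roots_multiset_prod_X_sub_C
      (Finset.univ.val.map (Sum.elim (fun i => A i i) fun i => (A i i)⁻¹))
    rw [Multiset.map_map] at hroots
    have hnodup := hreg.1
    rw [← hconj] at hnodup
    replace hnodup := hroots ▸ hnodup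
    exact fun x y hxy => Multiset.inj_on_of_nodup_map hnodup x (Finset.mem_univ x) y
      (Finset.mem_univ y) hxy
  have hmem (w : Matrix.symplecticGroup (Fin n) F)
      (hw : (w : Matrix (Fin n ⊕ Fin n) (Fin n ⊕ Fin n) F).charpoly =
        (s : Matrix (Fin n ⊕ Fin n) (Fin n ⊕ Fin n) F).charpoly) : w ∈ N := by
    obtain ⟨k, hk⟩ := SymplecticGroup.exists_conj_of_charpoly_eq s w _ hd hconj.symm hw
    exact hk ▸ hN s hs k
  refine Set.eq_univ_of_forall fun g => ?_
  obtain ⟨k, A', B', D', hA', hg⟩ := SymplecticGroup.exists_conj_upperTriangular h2 g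
  obtain ⟨x, y, z, hxyz, hw⟩ :=
    SymplecticGroup.exists_mul_mul_of_upperTriangular _ hA' hg _ hd0
  rw [hconj] at hw
  refine ⟨k * x * k⁻¹ * (k * y * k⁻¹), ⟨_, hN x (hmem x (hw x (by simp))) k, _,
    hN y (hmem y (hw y (by simp))) k, rfl⟩, _, hN z (hmem z (hw z (by simp))) k, ?_⟩
  calc k * x * k⁻¹ * (k * y * k⁻¹) * (k * z * k⁻¹) = k * (x * y * z) * k⁻¹ := by group
    _ = g := by rw [hxyz]; group
end
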